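/- There exists a constant C > 0 such that the following holds for every integer m ≥ 1: if A₁, A₂, …, Aₘ are finite sets of points in ℝ² that are pairwise linearly separable, B₁, B₂, …, Bₘ are pairwise disjoint Jordan curves with Aᵢ ⊆ Bᵢ for each i, and the union B₁ ∪ ⋯ ∪ Bₘ has stabbing number at most s (for some real s ≥ 2), then A₁ ∪ ⋯ ∪ Aₘ is contained in a Jordan curve with stabbing number at most s + C·√m. -/

import Mathlib

open Set

/-- Points of the plane. -/
abbrev Pt := ℝ × ℝ

/-- An affine line in ℝ², given by a nontrivial linear equation. -/
def IsAffLine (l : Set Pt) : Prop :=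
  ∃ a b c : ℝ, (a ≠ 0 ∨ b ≠ 0) ∧ l = {p : Pt | a * p.1 + b * p.2 = c}

/-- An open half-plane in ℝ². -/
def IsOpenHalfPlane (H : Set Pt) : Prop :=
  ∃ a b c : ℝ, (a ≠ 0 ∨ b ≠ 0) ∧ H = {p : Pt | a * p.1 + b * p.2 < c}

/-- `A` and `B` are linearly separable: some affine line has `A` strictly on
one side and `B` strictly on the other side. -/
def LinSep (A B : Set Pt) : Prop :=
  ∃ a b c : ℝ, (a ≠ 0 ∨ b ≠ 0) ∧ (∀ p ∈ A, a * p.1 + b * p.2 < c) ∧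
    (∀ p ∈ B, c < a * p.1 + b * p.2)

/-- General position: no three (distinct) points of `X` are collinear. -/
def GenPos (X : Set Pt) : Prop :=
  ∀ p ∈ X, ∀ q ∈ X, ∀ r ∈ X, p ≠ q → p ≠ r → q ≠ r →
    ¬ Collinear ℝ ({p, q, r} : Set Pt)

/-- Convex position: no point of `X` lies in the convex hull of the others. -/
def ConvexPos (X : Set Pt) : Prop :=
  ∀ p ∈ X, p ∉ convexHull ℝ (X \ {p})

/-- A cell of an arrangement `L` of lines: a connected component of the
complement of the union of the lines. -/
def IsCell (L : Set (Set Pt)) (cell : Set Pt) : Prop :=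
  ∃ p ∈ (⋃₀ L)ᶜ, cell = connectedComponentIn (⋃₀ L)ᶜ p

/-- `S` has at most `d` connected components: among any `d + 1` points of `S`,
two lie in the same connected component of `S`. -/
def CompsLE (S : Set Pt) (d : ℕ) : Prop :=
  ∀ f : Fin (d + 1) → Pt, (∀ i, f i ∈ S) →
    ∃ i j, i ≠ j ∧ connectedComponentIn S (f i) = connectedComponentIn S (f j)

/-- A Jordan curve: the image of a continuous injective map from the unit
circle to the plane. -/
def IsJordanCurve (J : Set Pt) : Prop :=
  ∃ f : EuclideanSpace ℝ (Fin 2) → Pt,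
    ContinuousOn f (Metric.sphere 0 1) ∧ Set.InjOn f (Metric.sphere 0 1) ∧
      J = f '' (Metric.sphere 0 1)

/-- `J` has stabbing number at most `d` (a natural number): every affine line
meets `J` in at most `d` connected components. -/
def StabLE (J : Set Pt) (d : ℕ) : Prop :=
  ∀ l, IsAffLine l → CompsLE (J ∩ l) d

/-- `J` has stabbing number at most a real number `d`: every affine line meets
`J` in at most `⌊d⌋₊` connected components. -/
def StabLER (J : Set Pt) (d : ℝ) : Prop :=
  ∀ l, IsAffLine l → CompsLE (J ∩ l) ⌊d⌋₊


open Set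

noncomputable section CycCost
open Classical

/-- cost of a path given by a list -/
def pc {α : Type*} (c : α → α → ℝ) : List α → ℝ
  | [] => 0
  | [_] => 0
  | a :: b :: t => c a b + pc c (b :: t)

/-- cost of the closed tour given by a list -/
def cyc {α : Type*} (c : α → α → ℝ) : List α → ℝ
  | [] => 0
  | a :: t => pc c (a :: t) + c ((a :: t).getLast (by simp)) a

/-- cut cost -/
def cut {α : Type*} (P : α → Prop) (u v : α) : ℝ := if (P u ↔ P v) then 0 else 1

lemma cut_nonneg {α : Type*} (P : α → Prop) (u v : α) : 0 ≤ cut P u v := by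
  unfold cut; split_ifs <;> norm_num

lemma cut_comm {α : Type*} (P : α → Prop) (u v : α) : cut P u v = cut P v u := by
  unfold cut; simp only [iff_comm]

lemma cut_self {α : Type*} (P : α → Prop) (u : α) : cut P u u = 0 := by
  simp [cut]

lemma cut_tri {α : Type*} (P : α → Prop) (u v w : α) : cut P u w ≤ cut P u v + cut P v w := by
  unfold cut
  by_cases h1 : P u <;> by_cases h2 : P v <;> by_cases h3 : P w <;> simp [h1, h2, h3]

lemma pc_cons {α : Type*} (c : α → α → ℝ) (a : α) (l : List α) (h : l ≠ []) :
    pc c (a :: l) = c a (l.head h) + pc c l := by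
  cases l with
  | nil => exact absurd rfl h
  | cons b t => simp [pc]

lemma pc_append {α : Type*} (c : α → α → ℝ) (l₁ l₂ : List α) (h₁ : l₁ ≠ []) (h₂ : l₂ ≠ []) :
    pc c (l₁ ++ l₂) = pc c l₁ + c (l₁.getLast h₁) (l₂.head h₂) + pc c l₂ := by
  induction l₁ with
  | nil => exact absurd rfl h₁
  | cons a t ih =>
    by_cases ht : t = []
    · subst ht
      simp [pc_cons c a l₂ h₂, pc]
    · have h3 : t ++ l₂ ≠ [] := by simp [ht]
      rw [List.cons_append, pc_cons c a _ h3, ih ht, pc_cons c a t ht, List.head_append_of_ne_nil ht,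
        List.getLast_cons ht]
      ring

lemma cyc_eq {α : Type*} (c : α → α → ℝ) (l : List α) (h : l ≠ []) :
    cyc c l = pc c l + c (l.getLast h) (l.head h) := by
  cases l with
  | nil => exact absurd rfl h
  | cons b t => simp [cyc]

lemma cyc_append {α : Type*} (c : α → α → ℝ) (l₁ l₂ : List α) (h₁ : l₁ ≠ []) (h₂ : l₂ ≠ []) :
    cyc c (l₁ ++ l₂) = pc c l₁ + c (l₁.getLast h₁) (l₂.head h₂) + pc c l₂ +
      c (l₂.getLast h₂) (l₁.head h₁) := by
  rw [cyc_eq c _ (by simp [h₁]), pc_append c _ _ h₁ h₂, List.head_append_of_ne_nil h₁,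
    List.getLast_append_of_ne_nil _ h₂]

lemma cyc_append_comm {α : Type*} (c : α → α → ℝ) (l₁ l₂ : List α) :
    cyc c (l₁ ++ l₂) = cyc c (l₂ ++ l₁) := by
  by_cases h₁ : l₁ = []
  · simp [h₁]
  by_cases h₂ : l₂ = []
  · simp [h₂]
  rw [cyc_append c _ _ h₁ h₂, cyc_append c _ _ h₂ h₁]; ring

lemma pc_reverse {α : Type*} (c : α → α → ℝ) (hc : ∀ u v, c u v = c v u) (l : List α) :
    pc c l.reverse = pc c l := by
  induction l with
  | nil => rfl
  | cons a t ih =>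
    by_cases ht : t = []
    · simp [ht]
    · rw [List.reverse_cons, pc_append c _ _ (by simpa using ht) (by simp), ih, pc_cons c a t ht]
      simp [pc, hc a]; ring

lemma cyc_twoopt {α : Type*} (c : α → α → ℝ) (hc : ∀ u v, c u v = c v u) (l₁ l₂ : List α)
    (h₁ : l₁ ≠ []) (h₂ : l₂ ≠ []) :
    cyc c (l₁.reverse ++ l₂) = cyc c (l₁ ++ l₂) - c (l₁.getLast h₁) (l₂.head h₂)
      - c (l₂.getLast h₂) (l₁.head h₁) + c (l₁.head h₁) (l₂.head h₂)
      + c (l₂.getLast h₂) (l₁.getLast h₁) := by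
  rw [cyc_append c _ _ (by simpa using h₁) h₂, cyc_append c _ _ h₁ h₂, pc_reverse c hc]
  simp; ring

lemma cyc_insert {α : Type*} (c : α → α → ℝ) (b : α) (l₁ l₂ : List α)
    (h₁ : l₁ ≠ []) (h₂ : l₂ ≠ []) :
    cyc c (l₁ ++ b :: l₂) = cyc c (b :: (l₁ ++ l₂)) - c b (l₁.head h₁) - c (l₂.getLast h₂) b
      - c (l₁.getLast h₁) (l₂.head h₂) + c (l₁.getLast h₁) b + c b (l₂.head h₂)
      + c (l₂.getLast h₂) (l₁.head h₁) := by
  rw [cyc_append c l₁ (b :: l₂) h₁ (by simp), cyc_eq c (b :: (l₁ ++ l₂)) (by simp),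
    pc_cons c b (l₁ ++ l₂) (by simp [h₁]), pc_append c _ _ h₁ h₂, pc_cons c b _ h₂,
    List.head_append_of_ne_nil h₁, List.getLast_cons h₂, List.getLast_cons (by simp [h₁, h₂]),
    List.getLast_append_of_ne_nil _ h₂]
  simp; ring

lemma pc_sum {α : Type*} [Inhabited α] (c : α → α → ℝ) (l : List α) :
    pc c l = ∑ i ∈ Finset.range (l.length - 1), c l[i]! l[i+1]! := by
  induction l with
  | nil => simp [pc]
  | cons a t ih =>
    by_cases ht : t = []
    · subst ht; simp [pc]
    · rw [pc_cons c a t ht, ih]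
      have : (a :: t).length - 1 = (t.length - 1) + 1 := by
        have := List.length_pos_iff.2 ht; simp; omega
      rw [this, Finset.sum_range_succ']
      have hh : t.head ht = t[0]! := by
        cases t with
        | nil => exact absurd rfl ht
        | cons b t => simp
      rw [hh, add_comm]; simp

lemma cyc_sum {α : Type*} [Inhabited α] (c : α → α → ℝ) (l : List α) :
    cyc c l = ∑ i ∈ Finset.range l.length, c l[i]! l[(i+1) % l.length]! := by
  by_cases hl : l = []
  · subst hl; simp [cyc]
  have hp := List.length_pos_iff.2 hl
  obtain ⟨n, hn⟩ : ∃ n, l.length = n + 1 := ⟨l.length - 1, by omega⟩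
  rw [cyc_eq c l hl, pc_sum, hn, Finset.sum_range_succ]
  congr 1
  · apply Finset.sum_congr (by simp)
    intro i hi
    rw [Finset.mem_range] at hi
    rw [Nat.mod_eq_of_lt (by omega)]
  · have h1 : l.getLast hl = l[n]! := by
      rw [List.getLast_eq_getElem, getElem!_pos l n (by omega)]; simp [hn]
    have h2 : l.head hl = l[0]! := by
      rw [List.head_eq_getElem, getElem!_pos l 0 (by omega)]
    rw [h1, h2]; simp

lemma cyc_congr_le {α : Type*} [Inhabited α] (c d : α → α → ℝ) (l : List α)
    (h : ∀ u ∈ l, ∀ v ∈ l, c u v ≤ d u v) : cyc c l ≤ cyc d l := by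
  rw [cyc_sum, cyc_sum]
  apply Finset.sum_le_sum
  intro i hi
  rw [Finset.mem_range] at hi
  have h2 : (i+1) % l.length < l.length := Nat.mod_lt _ (by omega)
  apply h
  · rw [getElem!_pos l i hi]; exact List.getElem_mem _
  · rw [getElem!_pos l _ h2]; exact List.getElem_mem _

end CycCost

open Set

noncomputable section SeqSimple
open Classical

/-- descending edge indicator -/
def dn (g : Pt →ₗ[ℝ] ℝ) (u v : Pt) : ℝ := if g v < g u then 1 else 0

/-- the line through `o` with direction `u`, parametrised by `g` -/
def OnM (g : Pt →ₗ[ℝ] ℝ) (o u : Pt) (x : Pt) : Prop := x = o + (g x - g o) • u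

lemma wbtw_g (g : Pt →ₗ[ℝ] ℝ) {x y z : Pt} (h : Wbtw ℝ x y z) :
    ∃ t : ℝ, 0 ≤ t ∧ t ≤ 1 ∧ g y = g x + t * (g z - g x) ∧ y = x + t • (z - x) := by
  obtain ⟨t, ⟨h0, h1⟩, rfl⟩ := h
  refine ⟨t, h0, h1, ?_, ?_⟩
  · simp [AffineMap.lineMap_apply]; ring
  · simp [AffineMap.lineMap_apply]; abel

lemma wbtw_ord (g : Pt →ₗ[ℝ] ℝ) {x y z : Pt} (h : Wbtw ℝ x y z) :
    (g x ≤ g y ∧ g y ≤ g z) ∨ (g z ≤ g y ∧ g y ≤ g x) := by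
  obtain ⟨t, h0, h1, h2, -⟩ := wbtw_g g h
  rcases le_total (g x) (g z) with h | h
  · left; constructor <;> nlinarith
  · right; constructor <;> nlinarith

lemma onM_mid {g : Pt →ₗ[ℝ] ℝ} {o u x y z : Pt} (hx : OnM g o u x) (hz : OnM g o u z)
    (h : Wbtw ℝ x y z) : OnM g o u y := by
  obtain ⟨t, h0, h1, h2, h3⟩ := wbtw_g g h
  unfold OnM at *
  rw [h2]
  generalize g x = X at *
  generalize g z = Z at *
  rw [h3, hx, hz]
  ext <;> simp <;> ring

lemma onM_ext {g : Pt →ₗ[ℝ] ℝ} {o u x y z : Pt} (hx : OnM g o u x) (hy : OnM g o u y)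
    (hxy : x ≠ y) (h : Wbtw ℝ x y z) : OnM g o u z := by
  obtain ⟨t, h0, h1, h2, h3⟩ := wbtw_g g h
  have ht : t ≠ 0 := by
    rintro rfl
    apply hxy; rw [h3]; simp
  unfold OnM at *
  have hz : z = x + t⁻¹ • (y - x) := by
    rw [h3]; simp [smul_smul, inv_mul_cancel₀ ht]
  have hgz : g z = g x + t⁻¹ * (g y - g x) := by
    rw [hz]; simp
  rw [hgz]
  generalize g x = X at *
  generalize g y = Y at *
  rw [hz, hx, hy]
  ext <;> simp <;> ring

lemma onM_inj {g : Pt →ₗ[ℝ] ℝ} {o u x y : Pt} (hx : OnM g o u x) (hy : OnM g o u y)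
    (h : g x = g y) : x = y := by
  unfold OnM at *
  rw [hx, hy, h]

lemma onM_wbtw {g : Pt →ₗ[ℝ] ℝ} {o u x y z : Pt} (hx : OnM g o u x) (hy : OnM g o u y)
    (hz : OnM g o u z) (h1 : g x ≤ g y) (h2 : g y ≤ g z) : Wbtw ℝ x y z := by
  by_cases hxz : g x = g z
  · have : x = y := onM_inj hx hy (by linarith)
    rw [← this]; exact wbtw_self_left ℝ x z
  have hlt : 0 < g z - g x := by
    have : g x < g z := lt_of_le_of_ne (by linarith) hxz
    linarith
  refine ⟨(g y - g x) / (g z - g x), ⟨by apply div_nonneg <;> linarith, by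
    rw [div_le_one hlt]; linarith⟩, ?_⟩
  unfold OnM at *
  rw [AffineMap.lineMap_apply]
  have : ∀ X Y Z O : ℝ, Z - X ≠ 0 → x = o + (X - O) • u → y = o + (Y - O) • u → z = o + (Z - O) • u →
      ((Y - X) / (Z - X)) • (z -ᵥ x) +ᵥ x = y := by
    intro X Y Z O hne hx hy hz
    rw [hx, hy, hz]
    ext <;> simp <;> field_simp <;> ring
  exact this _ _ _ _ hlt.ne' hx hy hz

lemma seq_up {n : ℕ} {v : ℕ → Pt} (g : Pt →ₗ[ℝ] ℝ)
    (per : ∀ i, v (i + n) = v i)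
    (inj : ∀ i j, i < j → j < i + n → v i ≠ v j)
    (hB : ∀ e f, e + 2 ≤ f → f < e + n → Wbtw ℝ (v f) (v (e+1)) (v (f+1)) →
      Wbtw ℝ (v e) (v (e+1)) (v (e+2)) ∧
        dn g (v e) (v (e+1)) + dn g (v (e+1)) (v (e+2)) + dn g (v f) (v (f+1)) ≤
          dn g (v e) (v (e+2)) + dn g (v f) (v (e+1)) + dn g (v (e+1)) (v (f+1)))
    (o u : Pt) (f e : ℕ) (hfe : f < e) (hef : e < f + n)
    (hr : OnM g o u (v f)) (hs : OnM g o u (v (f+1)))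
    (hdown : g (v (f+1)) < g (v f))
    (hp : OnM g o u (v e)) (hq : OnM g o u (v (e+1)))
    (hup : g (v e) < g (v (e+1))) (ho1 : g (v (f+1)) < g (v (e+1))) (ho2 : g (v e) < g (v f)) :
    g (v (f+1)) ≤ g (v e) ∧ g (v (e+1)) ≤ g (v f) := by
  constructor
  · by_contra! hlt
    have hne : e ≠ f + 1 := by rintro rfl; exact lt_irrefl _ hlt
    obtain ⟨h1, h2⟩ := hB f e (by omega) hef (onM_wbtw hp hs hq hlt.le ho1.le)
    have hc := onM_ext hr hs (fun h => by rw [h] at hdown; exact lt_irrefl _ hdown) h1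
    have hcs : g (v (f+2)) ≠ g (v (f+1)) := fun h =>
      inj (f+1) (f+2) (by omega) (by omega) (onM_inj hs hc h.symm)
    have : g (v (f+2)) < g (v (f+1)) := by
      by_contra! hh
      have : g (v (f+1)) < g (v (f+2)) := lt_of_le_of_ne hh hcs.symm
      rcases wbtw_ord g h1 with ⟨_, _⟩ | ⟨_, _⟩ <;> linarith
    have h4 : g (v (f+2)) < g (v f) := by linarith
    simp only [dn, hdown, this, h4, if_true, not_lt.2 hup.le, not_lt.2 hlt.le, not_lt.2 ho1.le, if_false] at h2
    norm_num at h2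
  · by_contra! hlt
    have hne : e + 1 ≠ f + n := by
      intro h; rw [h, per] at hlt; exact lt_irrefl _ hlt
    have e1 : f + n - 1 + 1 = f + n := by omega
    have e2 : f + n - 1 + 2 = f + 1 + n := by omega
    have e3 : e + n + 1 = e + 1 + n := by omega
    have hBB := hB (f + n - 1) (e + n) (by omega) (by omega)
    rw [e1, e2, e3, per, per, per, per] at hBB
    obtain ⟨h1, h2⟩ := hBB (onM_wbtw hp hr hq ho2.le hlt.le)
    have hc := onM_ext hs hr (fun h => by rw [h] at hdown; exact lt_irrefl _ hdown) h1.symm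
    have hcs : g (v (f+n-1)) ≠ g (v f) := fun h => by
      have := inj (f+n-1) (f+n) (by omega) (by omega)
      rw [per] at this
      exact this (onM_inj hc hr h)
    have : g (v f) < g (v (f+n-1)) := by
      by_contra! hh
      have : g (v (f+n-1)) < g (v f) := lt_of_le_of_ne hh hcs
      rcases wbtw_ord g h1 with ⟨_, _⟩ | ⟨_, _⟩ <;> linarith
    have h4 : g (v (f+1)) < g (v (f+n-1)) := by linarith
    simp only [dn, hdown, this, h4, if_true, not_lt.2 hup.le, not_lt.2 hlt.le, not_lt.2 ho2.le, if_false] at h2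
    norm_num at h2

lemma seq_overlap {n : ℕ} {v : ℕ → Pt} (g : Pt →ₗ[ℝ] ℝ)
    (per : ∀ i, v (i + n) = v i)
    (inj : ∀ i j, i < j → j < i + n → v i ≠ v j)
    (hB : ∀ e f, e + 2 ≤ f → f < e + n → Wbtw ℝ (v f) (v (e+1)) (v (f+1)) →
      Wbtw ℝ (v e) (v (e+1)) (v (e+2)) ∧
        dn g (v e) (v (e+1)) + dn g (v (e+1)) (v (e+2)) + dn g (v f) (v (f+1)) ≤
          dn g (v e) (v (e+2)) + dn g (v f) (v (e+1)) + dn g (v (e+1)) (v (f+1)))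
    (o u : Pt) (f e : ℕ) (hfe : f < e) (hef : e < f + n)
    (hr : OnM g o u (v f)) (hs : OnM g o u (v (f+1)))
    (hdown : g (v (f+1)) < g (v f))
    (hp : OnM g o u (v e)) (hq : OnM g o u (v (e+1)))
    (hup : g (v e) < g (v (e+1))) (ho1 : g (v (f+1)) < g (v (e+1))) (ho2 : g (v e) < g (v f)) :
    ∀ i, OnM g o u (v i) := by
  have I := seq_up g per inj hB o u f
  obtain ⟨i1, i2⟩ := I e hfe hef hr hs hdown hp hq hup ho1 ho2
  let Up : ℕ → Prop := fun e => OnM g o u (v e) ∧ OnM g o u (v (e+1)) ∧ g (v (f+1)) ≤ g (v e) ∧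
    g (v e) < g (v (e+1)) ∧ g (v (e+1)) ≤ g (v f)
  have hUp : Up e := ⟨hp, hq, i1, hup, i2⟩
  have fwd : ∀ k, e + k < f + n → Up (e + k) := by
    intro k
    induction k with
    | zero => intro _; exact hUp
    | succ k ih =>
      intro hk
      obtain ⟨a1, a2, a3, a4, a5⟩ := ih (by omega)
      have hne : g (v (e+k+1)) ≠ g (v f) := fun h => by
        have := inj (e+k+1) (f+n) (by omega) (by omega)
        rw [per] at this
        exact this (onM_inj a2 hr h)
      have hlt : g (v (e+k+1)) < g (v f) := lt_of_le_of_ne a5 hne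
      have hBB := hB (e+k) (f+n) (by omega) (by omega)
      rw [show f + n + 1 = f + 1 + n by omega, per, per] at hBB
      obtain ⟨h1, -⟩ := hBB (onM_wbtw hs a2 hr (by linarith) a5).symm
      have hM := onM_ext a1 a2 (fun h => by rw [← h] at a4; exact lt_irrefl _ a4) h1
      have hcs : g (v (e+k+2)) ≠ g (v (e+k+1)) := fun h =>
        inj (e+k+1) (e+k+2) (by omega) (by omega) (onM_inj a2 hM h.symm)
      have hl : g (v (e+k+1)) < g (v (e+k+2)) := by
        by_contra! hh
        have : g (v (e+k+2)) < g (v (e+k+1)) := lt_of_le_of_ne hh hcs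
        rcases wbtw_ord g h1 with ⟨_, _⟩ | ⟨_, _⟩ <;> linarith
      obtain ⟨j1, j2⟩ := I (e+k+1) (by omega) (by omega) hr hs hdown a2 hM hl (by linarith) hlt
      exact ⟨a2, hM, j1, hl, j2⟩
  have bwd : ∀ k, f + k < e → Up (e - k) := by
    intro k
    induction k with
    | zero => intro _; exact hUp
    | succ k ih =>
      intro hk
      obtain ⟨a1, a2, a3, a4, a5⟩ := ih (by omega)
      obtain ⟨d, hd⟩ : ∃ d, e - k = d + 1 := ⟨e - k - 1, by omega⟩
      have hd2 : e - (k+1) = d := by omega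
      rw [hd2]
      rw [hd] at a1 a2 a3 a4 a5
      have hne : g (v (d+1)) ≠ g (v (f+1)) := fun h => by
        have := inj (f+1) (d+1) (by omega) (by omega)
        exact this (onM_inj hs a1 h.symm)
      have hlt : g (v (f+1)) < g (v (d+1)) := lt_of_le_of_ne a3 hne.symm
      have hBB := hB d (f+n) (by omega) (by omega)
      rw [show f + n + 1 = f + 1 + n by omega, per, per] at hBB
      obtain ⟨h1, -⟩ := hBB (onM_wbtw hs a1 hr (by linarith) (by linarith)).symm
      have hM := onM_ext a2 a1 (fun h => by rw [← h] at a4; exact lt_irrefl _ a4) h1.symm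
      have hcs : g (v d) ≠ g (v (d+1)) := fun h =>
        inj d (d+1) (by omega) (by omega) (onM_inj hM a1 h)
      have a4' : g (v (d+1)) < g (v (d+2)) := a4
      have hl : g (v d) < g (v (d+1)) := by
        by_contra! hh
        have : g (v (d+1)) < g (v d) := lt_of_le_of_ne hh hcs.symm
        rcases wbtw_ord g h1 with ⟨_, _⟩ | ⟨_, _⟩ <;> linarith
      obtain ⟨j1, j2⟩ := I d (by omega) (by omega) hr hs hdown hM a1 hl hlt (by linarith)
      exact ⟨hM, a1, j1, hl, j2⟩
  have all : ∀ i, f < i → i < f + n → OnM g o u (v i) := by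
    intro i h1 h2
    by_cases h : e ≤ i
    · have := fwd (i - e) (by omega)
      rw [show e + (i - e) = i by omega] at this
      exact this.1
    · have := bwd (e - i) (by omega)
      rw [show e - (e - i) = i by omega] at this
      exact this.1
  have hn : 0 < n := by omega
  have perk : ∀ k i, v (i + k * n) = v i := by
    intro k; induction k with
    | zero => intro i; simp
    | succ k ih => intro i; rw [show i + (k+1) * n = (i + k * n) + n by ring, per, ih]
  intro i
  -- find representative
  have key : ∃ j, f ≤ j ∧ j < f + n ∧ v j = v i := by
    refine ⟨f + (i + f * n - f) % n, by omega, by have := Nat.mod_lt (i + f * n - f) hn; omega, ?_⟩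
    have hge : f ≤ f * n := Nat.le_mul_of_pos_right f hn
    have := Nat.div_add_mod (i + f * n - f) n
    have h2 : f + (i + f * n - f) % n + ((i + f * n - f) / n) * n = i + f * n := by
      rw [mul_comm ((i + f * n - f) / n) n]; omega
    rw [← perk ((i + f * n - f) / n), h2, perk]
  obtain ⟨j, j1, j2, j3⟩ := key
  rw [← j3]
  by_cases h : j = f
  · rw [h]; exact hr
  · exact all j (by omega) j2

lemma seq_simple {n : ℕ} {v : ℕ → Pt} (g : Pt →ₗ[ℝ] ℝ)
    (per : ∀ i, v (i + n) = v i)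
    (inj : ∀ i j, i < j → j < i + n → v i ≠ v j)
    (hg : ∀ i j, g (v i) = g (v j) → v i = v j)
    (hA : ∀ e f z, e < f → f < e + n → Wbtw ℝ (v e) z (v (e+1)) → Wbtw ℝ (v f) z (v (f+1)) →
      Wbtw ℝ (v e) z (v f) ∧ Wbtw ℝ (v (e+1)) z (v (f+1)))
    (hB : ∀ e f, e + 2 ≤ f → f < e + n → Wbtw ℝ (v f) (v (e+1)) (v (f+1)) →
      Wbtw ℝ (v e) (v (e+1)) (v (e+2)) ∧
        dn g (v e) (v (e+1)) + dn g (v (e+1)) (v (e+2)) + dn g (v f) (v (f+1)) ≤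
          dn g (v e) (v (e+2)) + dn g (v f) (v (e+1)) + dn g (v (e+1)) (v (f+1)))
    (e f : ℕ) (z : Pt) (hef : e < f) (hfe : f < e + n)
    (h1 : Wbtw ℝ (v e) z (v (e+1))) (h2 : Wbtw ℝ (v f) z (v (f+1)))
    (hz1 : z ≠ v (e+1)) (hz2 : z ≠ v (f+1)) :
    ∃ o u : Pt, ∀ i, OnM g o u (v i) := by
  obtain ⟨h3, h4⟩ := hA e f z hef hfe h1 h2
  have hpq : v e ≠ v (e+1) := inj e (e+1) (by omega) (by omega)
  have hpr : v e ≠ v f := inj e f hef hfe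
  have hgpq : g (v (e+1)) - g (v e) ≠ 0 := fun h => hpq (hg _ _ (by linarith))
  obtain ⟨o, ho⟩ : ∃ o, o = v e := ⟨_, rfl⟩
  obtain ⟨u, hu⟩ : ∃ u, u = (g (v (e+1)) - g (v e))⁻¹ • (v (e+1) - v e) := ⟨_, rfl⟩
  have hp : OnM g o u (v e) := by simp [OnM, ho]
  have hq : OnM g o u (v (e+1)) := by
    unfold OnM
    rw [ho, hu, smul_smul, mul_inv_cancel₀ hgpq]; simp
  have hz : OnM g o u z := onM_mid hp hq h1
  have hs : OnM g o u (v (f+1)) := onM_ext hq hz (Ne.symm hz1) h4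
  have hr : OnM g o u (v f) := onM_ext hs hz (Ne.symm hz2) h2.symm
  refine ⟨o, u, ?_⟩
  have gz1 : g z ≠ g (v (e+1)) := fun h => hz1 (onM_inj hz hq h)
  have gz2 : g z ≠ g (v (f+1)) := fun h => hz2 (onM_inj hz hs h)
  have gpr : g (v e) ≠ g (v f) := fun h => hpr (onM_inj hp hr h)
  rcases lt_or_gt_of_ne (show g (v e) ≠ g (v (e+1)) from fun h => hgpq (by linarith)) with hlt | hlt
  · have a1 : g (v e) ≤ g z := by
      rcases wbtw_ord g h1 with ⟨_, _⟩ | ⟨_, _⟩ <;> rcases wbtw_ord g h2 with ⟨_, _⟩ | ⟨_, _⟩ <;>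
        rcases wbtw_ord g h4 with ⟨_, _⟩ | ⟨_, _⟩ <;> linarith
    have a2 : g z < g (v (e+1)) := lt_of_le_of_ne (by
      rcases wbtw_ord g h1 with ⟨_, _⟩ | ⟨_, _⟩ <;> rcases wbtw_ord g h2 with ⟨_, _⟩ | ⟨_, _⟩ <;>
        rcases wbtw_ord g h4 with ⟨_, _⟩ | ⟨_, _⟩ <;> linarith) gz1
    have a3 : g (v (f+1)) < g z := by
      refine lt_of_le_of_ne ?_ gz2.symm
      by_contra! hh
      rcases wbtw_ord g h1 with ⟨_, _⟩ | ⟨_, _⟩ <;> rcases wbtw_ord g h2 with ⟨_, _⟩ | ⟨_, _⟩ <;>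
        rcases wbtw_ord g h4 with ⟨_, _⟩ | ⟨_, _⟩ <;> linarith
    have a4 : g z ≤ g (v f) := by
      by_contra! hh
      rcases wbtw_ord g h1 with ⟨_, _⟩ | ⟨_, _⟩ <;> rcases wbtw_ord g h2 with ⟨_, _⟩ | ⟨_, _⟩ <;>
        rcases wbtw_ord g h4 with ⟨_, _⟩ | ⟨_, _⟩ <;> linarith
    have a5 : g (v e) < g (v f) := lt_of_le_of_ne (by linarith) gpr
    have p1 : e + n + 1 = e + 1 + n := by omega
    have := seq_overlap g per inj hB o u f (e+n) (by omega) (by omega) hr hs (by linarith)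
    rw [p1, per, per] at this
    exact this hp hq hlt (by linarith) a5
  · have a1 : g z ≤ g (v e) := by
      rcases wbtw_ord g h1 with ⟨_, _⟩ | ⟨_, _⟩ <;> rcases wbtw_ord g h2 with ⟨_, _⟩ | ⟨_, _⟩ <;>
        rcases wbtw_ord g h4 with ⟨_, _⟩ | ⟨_, _⟩ <;> linarith
    have a2 : g (v (e+1)) < g z := lt_of_le_of_ne (by
      rcases wbtw_ord g h1 with ⟨_, _⟩ | ⟨_, _⟩ <;> rcases wbtw_ord g h2 with ⟨_, _⟩ | ⟨_, _⟩ <;>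
        rcases wbtw_ord g h4 with ⟨_, _⟩ | ⟨_, _⟩ <;> linarith) gz1.symm
    have a3 : g z < g (v (f+1)) := by
      refine lt_of_le_of_ne ?_ gz2
      by_contra! hh
      rcases wbtw_ord g h1 with ⟨_, _⟩ | ⟨_, _⟩ <;> rcases wbtw_ord g h2 with ⟨_, _⟩ | ⟨_, _⟩ <;>
        rcases wbtw_ord g h4 with ⟨_, _⟩ | ⟨_, _⟩ <;> linarith
    have a4 : g (v f) ≤ g z := by
      by_contra! hh
      rcases wbtw_ord g h1 with ⟨_, _⟩ | ⟨_, _⟩ <;> rcases wbtw_ord g h2 with ⟨_, _⟩ | ⟨_, _⟩ <;>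
        rcases wbtw_ord g h4 with ⟨_, _⟩ | ⟨_, _⟩ <;> linarith
    have a5 : g (v f) < g (v e) := lt_of_le_of_ne (by linarith) gpr.symm
    exact seq_overlap g per inj hB o u e f hef hfe hp hq hlt hr hs (by linarith) (by linarith) a5

end SeqSimple

open Set

noncomputable section Uncross
open Classical

/-- open half plane predicate -/
def HP (a b c : ℝ) (p : Pt) : Prop := c < a * p.1 + b * p.2

/-- Euclidean distance -/
def ed (u v : Pt) : ℝ := dist (Complex.equivRealProdLm.symm u) (Complex.equivRealProdLm.symm v)

lemma ed_comm (u v : Pt) : ed u v = ed v u := dist_comm _ _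

lemma ed_tri (u v w : Pt) : ed u w ≤ ed u v + ed v w := dist_triangle _ _ _

lemma ed_wbtw {x y z : Pt} : ed x y + ed y z = ed x z ↔ Wbtw ℝ x y z := by
  unfold ed
  rw [dist_add_dist_eq_iff]
  have := Function.Injective.wbtw_map_iff (R := ℝ) (x := x) (y := y) (z := z)
    (f := (Complex.equivRealProdLm.symm : Pt →ₗ[ℝ] ℂ).toAffineMap)
    (Complex.equivRealProdLm.symm.injective)
  simpa using this

lemma cut_wbtw {a b c : ℝ} {x y z : Pt} (h : Wbtw ℝ x y z) :
    cut (HP a b c) x y + cut (HP a b c) y z ≤ cut (HP a b c) x z := by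
  obtain ⟨t, ⟨h0, h1⟩, rfl⟩ := h
  unfold cut HP
  have e : a * ((AffineMap.lineMap x z) t).1 + b * ((AffineMap.lineMap x z) t).2 =
      (1 - t) * (a * x.1 + b * x.2) + t * (a * z.1 + b * z.2) := by
    simp [AffineMap.lineMap_apply]; ring
  rw [e]
  by_cases h2 : c < a * x.1 + b * x.2 <;> by_cases h3 : c < a * z.1 + b * z.2
  · have : c < (1 - t) * (a * x.1 + b * x.2) + t * (a * z.1 + b * z.2) := by
      rcases eq_or_lt_of_le h0 with h | h
      · rw [← h]; linarith
      · nlinarith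
    simp [h2, h3, this]
  · by_cases h4 : c < (1 - t) * (a * x.1 + b * x.2) + t * (a * z.1 + b * z.2) <;> simp [h2, h3, h4]
  · by_cases h4 : c < (1 - t) * (a * x.1 + b * x.2) + t * (a * z.1 + b * z.2) <;> simp [h2, h3, h4]
  · have : ¬ c < (1 - t) * (a * x.1 + b * x.2) + t * (a * z.1 + b * z.2) := by
      push Not at *
      nlinarith
    simp [h2, h3, this]

/-- admissible tours -/
def TT (V : Finset Pt) (N : ℝ) : Set (List Pt) :=
  {l | l.Nodup ∧ l.toFinset = V ∧ ∀ a b c, cyc (cut (HP a b c)) l ≤ N}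

lemma TT_finite (V : Finset Pt) (N : ℝ) : (TT V N).Finite := by
  apply Set.Finite.subset (List.finite_toSet (V.toList.permutations))
  rintro l ⟨h1, h2, -⟩
  simp only [Set.mem_ofPred_eq, List.mem_permutations]
  rw [List.perm_ext_iff_of_nodup h1 V.nodup_toList]
  intro a
  rw [Finset.mem_toList, ← h2, List.mem_toFinset]

/-- optimal tours -/
def Best (V : Finset Pt) (N : ℝ) (g : Pt →ₗ[ℝ] ℝ) (l : List Pt) : Prop :=
  l ∈ TT V N ∧ ∀ l' ∈ TT V N, cyc ed l ≤ cyc ed l' ∧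
    (cyc ed l = cyc ed l' → cyc (dn g) l ≤ cyc (dn g) l')

lemma exists_best (V : Finset Pt) (N : ℝ) (g : Pt →ₗ[ℝ] ℝ) (h : (TT V N).Nonempty) :
    ∃ l, Best V N g l := by
  obtain ⟨l, h1, h2⟩ := Set.exists_min_image (TT V N)
    (fun l => toLex (cyc ed l, cyc (dn g) l)) (TT_finite V N) h
  refine ⟨l, h1, fun l' hl' => ?_⟩
  have := h2 l' hl'
  rw [Prod.Lex.toLex_le_toLex] at this
  simp only at this
  rcases this with h | ⟨h, h'⟩
  · exact ⟨h.le, fun e => absurd e h.ne⟩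
  · exact ⟨h.le, fun _ => h'⟩

lemma best_comm {V : Finset Pt} {N : ℝ} {g : Pt →ₗ[ℝ] ℝ} {l₁ l₂ : List Pt}
    (h : Best V N g (l₁ ++ l₂)) : Best V N g (l₂ ++ l₁) := by
  obtain ⟨⟨h1, h2, h3⟩, h4⟩ := h
  refine ⟨⟨?_, ?_, ?_⟩, ?_⟩
  · exact (List.perm_append_comm.nodup_iff).1 h1
  · rw [← h2]; ext; simp [or_comm]
  · intro a b c; rw [cyc_append_comm]; exact h3 a b c
  · intro l' hl'
    rw [cyc_append_comm _ l₂ l₁, cyc_append_comm _ l₂ l₁]; exact h4 l' hl'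

lemma best_twoopt {V : Finset Pt} {N : ℝ} {g : Pt →ₗ[ℝ] ℝ} {l₁ l₂ : List Pt}
    (h₁ : l₁ ≠ []) (h₂ : l₂ ≠ [])
    (h : Best V N g (l₁ ++ l₂)) {p q r s : Pt} (hp : l₂.getLast h₂ = p) (hq : l₁.head h₁ = q)
    (hr : l₁.getLast h₁ = r) (hs : l₂.head h₂ = s) (z : Pt)
    (hz1 : Wbtw ℝ p z q) (hz2 : Wbtw ℝ r z s) : Wbtw ℝ p z r ∧ Wbtw ℝ q z s := by
  obtain ⟨⟨n1, n2, n3⟩, hmin⟩ := h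
  have hT : l₁.reverse ++ l₂ ∈ TT V N := by
    refine ⟨?_, ?_, ?_⟩
    · exact (((List.reverse_perm l₁).append_right l₂).nodup_iff).2 n1
    · rw [← n2]; ext; simp
    · intro a b c
      have h0 := n3 a b c
      rw [cyc_twoopt _ (cut_comm _) l₁ l₂ h₁ h₂, hp, hq, hr, hs]
      have c1 := cut_wbtw (a := a) (b := b) (c := c) hz1
      have c2 := cut_wbtw (a := a) (b := b) (c := c) hz2
      have c3 := cut_tri (HP a b c) p z r
      have c4 := cut_tri (HP a b c) q z s
      rw [cut_comm _ z r] at c3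
      rw [cut_comm _ q z] at c4
      linarith
  have h0 := (hmin _ hT).1
  rw [cyc_twoopt _ ed_comm l₁ l₂ h₁ h₂, hp, hq, hr, hs] at h0
  have c1 := ed_wbtw.2 hz1
  have c2 := ed_wbtw.2 hz2
  have c3 := ed_tri p z r
  have c4 := ed_tri q z s
  rw [ed_comm r z] at c2
  rw [ed_comm z q] at c1
  constructor
  · rw [← ed_wbtw]; linarith
  · rw [← ed_wbtw]; linarith

lemma best_insert {V : Finset Pt} {N : ℝ} {g : Pt →ₗ[ℝ] ℝ} {b : Pt} {l₁ l₂ : List Pt}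
    (h₁ : l₁ ≠ []) (h₂ : l₂ ≠ [])
    (h : Best V N g (b :: (l₁ ++ l₂))) {x y a c : Pt} (hx : l₁.getLast h₁ = x)
    (hy : l₂.head h₂ = y) (ha : l₂.getLast h₂ = a) (hc : l₁.head h₁ = c)
    (hb : Wbtw ℝ x b y) : Wbtw ℝ a b c ∧
      dn g a b + dn g b c + dn g x y ≤ dn g a c + dn g x b + dn g b y := by
  obtain ⟨⟨n1, n2, n3⟩, hmin⟩ := h
  have hT : l₁ ++ b :: l₂ ∈ TT V N := by
    refine ⟨?_, ?_, ?_⟩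
    · exact (List.perm_middle.nodup_iff).2 n1
    · rw [← n2]; ext; simp
    · intro a' b' c'
      have h0 := n3 a' b' c'
      rw [cyc_insert _ b l₁ l₂ h₁ h₂, hx, hy, ha, hc]
      have c1 := cut_wbtw (a := a') (b := b') (c := c') hb
      have c3 := cut_tri (HP a' b' c') a b c
      linarith
  obtain ⟨h0, h0'⟩ := hmin _ hT
  rw [cyc_insert _ b l₁ l₂ h₁ h₂, hx, hy, ha, hc] at h0 h0'
  rw [cyc_insert _ b l₁ l₂ h₁ h₂, hx, hy, ha, hc] at h0'
  have c1 := ed_wbtw.2 hb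
  have c3 := ed_tri a b c
  constructor
  · rw [← ed_wbtw]; linarith
  · have := h0' (by linarith)
    linarith

/-- vertices of a cyclic list -/
def vt (l : List Pt) (i : ℕ) : Pt := l[i % l.length]!

lemma vt_rotate (l : List Pt) (k i : ℕ) (hi : i < l.length) :
    (l.rotate k)[i]'(by simpa using hi) = vt l (k + i) := by
  have h2 : (k + i) % l.length < l.length := Nat.mod_lt _ (by omega)
  rw [List.getElem_rotate, vt, getElem!_pos l _ h2]
  congr 2
  omega

lemma best_rotate {V : Finset Pt} {N : ℝ} {g : Pt →ₗ[ℝ] ℝ} {l : List Pt}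
    (h : Best V N g l) (k : ℕ) : Best V N g (l.rotate k) := by
  rw [← List.rotate_mod]
  by_cases hl : l = []
  · simpa [hl] using h
  rw [List.rotate_eq_drop_append_take (Nat.mod_lt _ (List.length_pos_iff.2 hl)).le]
  apply best_comm
  rwa [List.take_append_drop]

lemma best_A {V : Finset Pt} {N : ℝ} {g : Pt →ₗ[ℝ] ℝ} {l : List Pt} (h : Best V N g l)
    (e f : ℕ) (z : Pt) (hef : e < f) (hfe : f < e + l.length)
    (h1 : Wbtw ℝ (vt l e) z (vt l (e+1))) (h2 : Wbtw ℝ (vt l f) z (vt l (f+1))) :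
    Wbtw ℝ (vt l e) z (vt l f) ∧ Wbtw ℝ (vt l (e+1)) z (vt l (f+1)) := by
  have hb := best_rotate h (e+1)
  set l' := l.rotate (e+1) with hl'
  have hlen : l'.length = l.length := by simp [hl']
  rw [← List.take_append_drop (f - e) l'] at hb
  have key : ∀ i, (hi : i < l.length) → l'[i]'(by omega) = vt l (e + 1 + i) := fun i hi =>
    vt_rotate l (e+1) i hi
  have n1 : List.take (f - e) l' ≠ [] := by
    rw [← List.length_pos_iff, List.length_take]; omega
  have n2 : List.drop (f - e) l' ≠ [] := by
    rw [← List.length_pos_iff, List.length_drop]; omega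
  refine best_twoopt n1 n2 hb ?_ ?_ ?_ ?_ z h1 h2
  · rw [List.getLast_drop, List.getLast_eq_getElem, key _ (by omega), hlen,
      show e + 1 + (l.length - 1) = e + l.length by omega]
    simp [vt]
  · rw [List.head_take, List.head_eq_getElem, key _ (by omega)]
  · rw [List.getLast_eq_getElem, List.getElem_take, key _ (by simp; omega)]
    congr 1; simp; omega
  · rw [List.head_eq_getElem, List.getElem_drop, key _ (by omega)]
    congr 1; omega

lemma best_B {V : Finset Pt} {N : ℝ} {g : Pt →ₗ[ℝ] ℝ} {l : List Pt} (h : Best V N g l)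
    (e f : ℕ) (hef : e + 2 ≤ f) (hfe : f < e + l.length)
    (h1 : Wbtw ℝ (vt l f) (vt l (e+1)) (vt l (f+1))) :
    Wbtw ℝ (vt l e) (vt l (e+1)) (vt l (e+2)) ∧
        dn g (vt l e) (vt l (e+1)) + dn g (vt l (e+1)) (vt l (e+2)) + dn g (vt l f) (vt l (f+1)) ≤
          dn g (vt l e) (vt l (e+2)) + dn g (vt l f) (vt l (e+1)) + dn g (vt l (e+1)) (vt l (f+1)) := by
  have hb := best_rotate h (e+1)
  obtain ⟨l', hl'⟩ : ∃ l', l' = l.rotate (e+1) := ⟨_, rfl⟩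
  rw [← hl'] at hb
  have hlen : l'.length = l.length := by simp [hl']
  have key : ∀ i, (hi : i < l.length) → l'[i]'(by omega) = vt l (e + 1 + i) := fun i hi => by
    have := vt_rotate l (e+1) i hi
    simp only [← hl'] at this; exact this
  clear hl'
  cases l' with
  | nil => simp at hlen; omega
  | cons b t =>
    have hbv : b = vt l (e+1) := key 0 (by omega)
    have keyt : ∀ i, (hi : i + 1 < l.length) → t[i]'(by simp at hlen; omega) = vt l (e + 2 + i) :=
      fun i hi => by
        have := key (i+1) hi
        rw [List.getElem_cons_succ] at this
        rw [this]; congr 1; omega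
    simp at hlen
    rw [← List.take_append_drop (f - e - 1) t] at hb
    have n1 : List.take (f - e - 1) t ≠ [] := by
      rw [← List.length_pos_iff, List.length_take]; omega
    have n2 : List.drop (f - e - 1) t ≠ [] := by
      rw [← List.length_pos_iff, List.length_drop]; omega
    rw [← hbv] at h1 ⊢
    refine best_insert n1 n2 hb ?_ ?_ ?_ ?_ h1
    · rw [List.getLast_eq_getElem, List.getElem_take, keyt _ (by simp; omega)]
      congr 1; simp; omega
    · rw [List.head_eq_getElem, List.getElem_drop, keyt _ (by omega)]
      congr 1; omega
    · rw [List.getLast_drop, List.getLast_eq_getElem, keyt _ (by omega),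
        show e + 2 + (t.length - 1) = e + l.length by omega]
      simp [vt]
    · rw [List.head_take, List.head_eq_getElem, keyt _ (by omega)]

lemma exists_g (V : Finset Pt) : ∃ g : Pt →ₗ[ℝ] ℝ, ∀ x ∈ V, ∀ y ∈ V, g x = g y → x = y := by
  let bad : Finset ℝ := (V ×ˢ V).image fun p => -(p.1.1 - p.2.1) / (p.1.2 - p.2.2)
  obtain ⟨t, ht⟩ := Infinite.exists_notMem_finset bad
  refine ⟨LinearMap.fst ℝ ℝ ℝ + t • LinearMap.snd ℝ ℝ ℝ, ?_⟩
  intro x hx y hy h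
  simp at h
  by_cases h2 : x.2 - y.2 = 0
  · ext
    · have : x.2 = y.2 := by linarith
      rw [this] at h; linarith
    · linarith
  · exfalso
    apply ht
    simp only [bad, Finset.mem_image, Finset.mem_product]
    refine ⟨(x, y), ⟨hx, hy⟩, ?_⟩
    simp only
    field_simp
    linarith

theorem uncross (V : Finset Pt) (hV : ¬ Collinear ℝ (V : Set Pt)) (N : ℝ) (hne : (TT V N).Nonempty) :
    ∃ l ∈ TT V N, ∀ e f z, e < f → f < e + l.length →
      Wbtw ℝ (vt l e) z (vt l (e+1)) → Wbtw ℝ (vt l f) z (vt l (f+1)) →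
      z ≠ vt l (e+1) → z ≠ vt l (f+1) → False := by
  obtain ⟨g, hg⟩ := exists_g V
  obtain ⟨l, hl⟩ := exists_best V N g hne
  refine ⟨l, hl.1, ?_⟩
  intro e f z hef hfe h1 h2 h3 h4
  have hpos : 0 < l.length := by omega
  have hmem : ∀ i, vt l i ∈ V := by
    intro i
    rw [← hl.1.2.1, List.mem_toFinset, vt, getElem!_pos l _ (Nat.mod_lt _ hpos)]
    exact List.getElem_mem _
  obtain ⟨o, u, hM⟩ := seq_simple (v := vt l) (n := l.length) g
    (by intro i; simp [vt])
    (by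
      intro i j hij hji hv
      rw [vt, vt, getElem!_pos l _ (Nat.mod_lt _ hpos), getElem!_pos l _ (Nat.mod_lt _ hpos)] at hv
      have := (List.Nodup.getElem_inj_iff hl.1.1).1 hv
      have h5 : i ≡ j [MOD l.length] := this
      have := (Nat.modEq_iff_dvd' hij.le).1 h5
      have := Nat.le_of_dvd (by omega) this
      omega)
    (fun i j => hg _ (hmem i) _ (hmem j))
    (fun e f z => best_A hl e f z) (fun e f => best_B hl e f) e f z hef hfe h1 h2 h3 h4
  apply hV
  rw [collinear_iff_exists_forall_eq_smul_vadd]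
  refine ⟨o, u, ?_⟩
  intro p hp
  have hp' : p ∈ l := by
    rw [← List.mem_toFinset, hl.1.2.1]; exact hp
  obtain ⟨i, hi, rfl⟩ := List.getElem_of_mem hp'
  have := hM i
  have e1 : vt l i = l[i] := by
    rw [vt, Nat.mod_eq_of_lt hi, getElem!_pos l _ hi]
  rw [e1] at this
  exact ⟨g l[i] - g o, by rw [vadd_eq_add, add_comm]; exact this⟩

end Uncross

open Set

noncomputable section JordanPar
open Classical

def sphHomeo : Circle ≃ₜ (Metric.sphere (0 : EuclideanSpace ℝ (Fin 2)) 1) where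
  toFun z := ⟨Complex.orthonormalBasisOneI.repr (z : ℂ), by
    rw [mem_sphere_zero_iff_norm, LinearIsometryEquiv.norm_map]; exact Circle.norm_coe z⟩
  invFun x := ⟨Complex.orthonormalBasisOneI.repr.symm x.1, by
    have := x.2
    rw [mem_sphere_zero_iff_norm] at this
    apply mem_sphere_zero_iff_norm.2
    rw [LinearIsometryEquiv.norm_map, this]⟩
  left_inv z := by
    apply Circle.ext
    exact LinearIsometryEquiv.symm_apply_apply _ _
  right_inv x := by
    apply Subtype.ext
    exact LinearIsometryEquiv.apply_symm_apply _ _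
  continuous_toFun := by
    apply Continuous.subtype_mk
    exact (LinearIsometryEquiv.continuous _).comp continuous_subtype_val
  continuous_invFun := by
    apply Continuous.subtype_mk
    exact (LinearIsometryEquiv.continuous _).comp continuous_subtype_val

lemma jordan_iff (J : Set Pt) : IsJordanCurve J ↔
    ∃ F : AddCircle (1:ℝ) → Pt, Continuous F ∧ Function.Injective F ∧ J = range F := by
  let h : AddCircle (1:ℝ) ≃ₜ (Metric.sphere (0 : EuclideanSpace ℝ (Fin 2)) 1) :=
    (AddCircle.homeomorphCircle one_ne_zero).trans sphHomeo
  constructor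
  · rintro ⟨f, hc, hi, rfl⟩
    refine ⟨fun t => f (h t), ?_, ?_, ?_⟩
    · exact (continuousOn_iff_continuous_domRestrict.1 hc).comp h.continuous
    · intro a b hab
      exact h.injective (Subtype.ext (hi (h a).2 (h b).2 hab))
    · ext p; constructor
      · rintro ⟨x, hx, rfl⟩
        exact ⟨h.symm ⟨x, hx⟩, by simp⟩
      · rintro ⟨t, rfl⟩
        exact ⟨h t, (h t).2, rfl⟩
  · rintro ⟨F, hc, hi, rfl⟩
    let f : EuclideanSpace ℝ (Fin 2) → Pt := fun x => if hx : x ∈ Metric.sphere (0 : EuclideanSpace ℝ (Fin 2)) 1 then F (h.symm ⟨x, hx⟩) else 0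
    have hf : ∀ x : Metric.sphere (0 : EuclideanSpace ℝ (Fin 2)) 1, f x = F (h.symm x) := by
      intro x
      simp only [f]
      rw [dif_pos x.2]
    refine ⟨f, ?_, ?_, ?_⟩
    · rw [continuousOn_iff_continuous_domRestrict]
      have : (Metric.sphere (0 : EuclideanSpace ℝ (Fin 2)) 1).domRestrict f = fun x => F (h.symm x) := by
        ext1 x; exact hf x
      rw [this]
      exact hc.comp h.symm.continuous
    · intro a ha b hb hab
      have := hf ⟨a, ha⟩
      have h2 := hf ⟨b, hb⟩
      simp only at this h2
      rw [this, h2] at hab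
      have := h.symm.injective (hi hab)
      exact congrArg Subtype.val this
    · ext p; constructor
      · rintro ⟨t, rfl⟩
        exact ⟨h t, (h t).2, by rw [hf]; simp⟩
      · rintro ⟨x, hx, rfl⟩
        exact ⟨h.symm ⟨x, hx⟩, (hf ⟨x, hx⟩).symm⟩

lemma jordan_of_path (γ : ℝ → Pt) (T : ℝ) (hT : 0 < T) (hc : Continuous γ) (h0 : γ 0 = γ T)
    (hi : InjOn γ (Ico 0 T)) : IsJordanCurve (γ '' Icc 0 T) := by
  rw [jordan_iff]
  have : Fact ((0:ℝ) < 1) := ⟨one_pos⟩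
  let g : ℝ → Pt := fun t => γ (T * t)
  have hlt : ∀ x ∈ Ico (0:ℝ) 1, T * x ∈ Ico 0 T := fun x hx => ⟨by have := hx.1; positivity, by nlinarith [hx.2]⟩
  have hv : ∀ x ∈ Ico (0:ℝ) 1, AddCircle.liftIco (1:ℝ) 0 g x = γ (T * x) := by
    intro x hx
    exact AddCircle.liftIco_zero_coe_apply hx
  have hsurj : ∀ q : AddCircle (1:ℝ), ∃ x ∈ Ico (0:ℝ) 1, (x : AddCircle (1:ℝ)) = q := by
    intro q
    have := AddCircle.coe_image_Ico_eq (1:ℝ) 0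
    have h2 : q ∈ (univ : Set (AddCircle (1:ℝ))) := mem_univ _
    rw [← this] at h2
    simpa using h2
  refine ⟨AddCircle.liftIco 1 0 g, ?_, ?_, ?_⟩
  · apply AddCircle.liftIco_zero_continuous
    · simp [g, h0]
    · exact (hc.comp (continuous_const.mul continuous_id)).continuousOn
  · intro p q hpq
    obtain ⟨x, hx, rfl⟩ := hsurj p
    obtain ⟨y, hy, rfl⟩ := hsurj q
    rw [hv x hx, hv y hy] at hpq
    have := hi (hlt x hx) (hlt y hy) hpq
    rw [mul_left_cancel₀ hT.ne' this]
  · ext p; constructor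
    · rintro ⟨t, ht, rfl⟩
      rcases eq_or_lt_of_le ht.2 with h | h
      · refine ⟨((0:ℝ) : AddCircle (1:ℝ)), ?_⟩
        rw [hv 0 (by simp), h, ← h0]; simp
      · refine ⟨((t / T:ℝ) : AddCircle (1:ℝ)), ?_⟩
        rw [hv _ ⟨div_nonneg ht.1 hT.le, (div_lt_one hT).2 h⟩, mul_div_cancel₀ _ hT.ne']
    · rintro ⟨q, rfl⟩
      obtain ⟨x, hx, rfl⟩ := hsurj q
      rw [hv x hx]
      exact ⟨T * x, ⟨(hlt x hx).1, (hlt x hx).2.le⟩, rfl⟩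

lemma path_of_jordan (B : Set Pt) (hB : IsJordanCurve B) (p : Pt) (hp : p ∈ B) :
    ∃ γ : ℝ → Pt, Continuous γ ∧ γ 0 = p ∧ γ 1 = p ∧ InjOn γ (Ico 0 1) ∧ B = γ '' Icc 0 1 := by
  rw [jordan_iff] at hB
  obtain ⟨F, hc, hi, rfl⟩ := hB
  obtain ⟨q, rfl⟩ := hp
  have : Fact ((0:ℝ) < 1) := ⟨one_pos⟩
  refine ⟨fun t => F ((t : AddCircle (1:ℝ)) + q), ?_, ?_, ?_, ?_, ?_⟩
  · exact hc.comp (Continuous.add (AddCircle.continuous_mk' 1) continuous_const)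
  · simp
  · have : ((1:ℝ) : AddCircle (1:ℝ)) = 0 := AddCircle.coe_period 1
    simp [this]
  · intro x hx y hy hxy
    have h1 := add_right_cancel (hi hxy)
    exact (AddCircle.coe_eq_coe_iff_of_mem_Ico (a := 0) (by simpa using hx) (by simpa using hy)).1 h1
  · ext p; constructor
    · rintro ⟨r, rfl⟩
      have h2 : r - q ∈ (univ : Set (AddCircle (1:ℝ))) := mem_univ _
      rw [← AddCircle.coe_image_Ico_eq (1:ℝ) 0] at h2
      obtain ⟨x, hx, hxr⟩ := h2
      refine ⟨x, ⟨hx.1, by have := hx.2; linarith⟩, ?_⟩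
      simp only; rw [hxr]; simp
    · rintro ⟨t, _, rfl⟩
      exact ⟨_, rfl⟩

end JordanPar

open Set

noncomputable section Polygon
open Classical

/-- closed polygonal path -/
def pg (v : ℕ → Pt) (n : ℕ) (t : ℝ) : Pt :=
  v 0 + ∑ k ∈ Finset.range n, (max 0 (min 1 (t - k))) • (v (k+1) - v k)

lemma pg_cont (v : ℕ → Pt) (n : ℕ) : Continuous (pg v n) := by
  unfold pg; fun_prop

lemma pg_eq (v : ℕ → Pt) (n k : ℕ) (hk : k < n) (t : ℝ) (h1 : k ≤ t) (h2 : t ≤ k + 1) :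
    pg v n t = AffineMap.lineMap (v k) (v (k+1)) (t - k) := by
  obtain ⟨r, rfl⟩ : ∃ r, n = k + 1 + r := ⟨n - (k+1), by omega⟩
  unfold pg
  rw [Finset.sum_range_add, Finset.sum_range_succ]
  have e1 : ∑ x ∈ Finset.range k, (max 0 (min 1 (t - x))) • (v (x+1) - v x) = v k - v 0 := by
    rw [← Finset.sum_range_sub]
    apply Finset.sum_congr rfl
    intro x hx
    rw [Finset.mem_range] at hx
    have : (x:ℝ) + 1 ≤ k := by exact_mod_cast hx
    rw [min_eq_left (by linarith), max_eq_right (by norm_num), one_smul]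
  have e2 : ∑ x ∈ Finset.range r, (max 0 (min 1 (t - (k + 1 + x : ℕ)))) • (v (k+1+x+1) - v (k+1+x)) = 0 := by
    apply Finset.sum_eq_zero
    intro x hx
    have : (0:ℝ) ≤ x := by positivity
    rw [max_eq_left, zero_smul]
    push_cast
    exact (min_le_right _ _).trans (by linarith)
  rw [e1, e2, min_eq_right (by linarith), max_eq_right (by linarith), AffineMap.lineMap_apply]
  simp only [vsub_eq_sub, vadd_eq_add]
  abel

lemma pg_image (v : ℕ → Pt) (n : ℕ) (hn : 0 < n) (z : Pt) : z ∈ pg v n '' Icc 0 n ↔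
    ∃ k < n, Wbtw ℝ (v k) z (v (k+1)) := by
  constructor
  · rintro ⟨t, ht, rfl⟩
    rcases eq_or_lt_of_le ht.2 with h | h
    · refine ⟨n - 1, by omega, ?_⟩
      have : ((n - 1 : ℕ) : ℝ) = n - 1 := by rw [Nat.cast_sub hn]; simp
      rw [pg_eq v n (n-1) (by omega) t (by rw [this]; linarith) (by rw [this]; linarith)]
      exact ⟨_, ⟨by rw [this]; linarith, by rw [this]; linarith⟩, rfl⟩
    · have h3 := Nat.floor_le ht.1
      have h4 := (Nat.lt_floor_add_one t).le
      refine ⟨⌊t⌋₊, (Nat.floor_lt ht.1).2 h, ?_⟩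
      rw [pg_eq v n _ ((Nat.floor_lt ht.1).2 h) t h3 h4]
      exact ⟨_, ⟨by linarith, by linarith⟩, rfl⟩
  · rintro ⟨k, hk, s, hs, rfl⟩
    have : (k:ℝ) + 1 ≤ n := by exact_mod_cast hk
    refine ⟨k + s, ⟨by have := hs.1; positivity, by linarith [hs.2]⟩, ?_⟩
    rw [pg_eq v n k hk _ (by linarith [hs.1]) (by linarith [hs.2])]
    simp

lemma pg_image' (v : ℕ → Pt) (n : ℕ) (hn : 0 < n) (hper : ∀ i, v (i + n) = v i) (z : Pt) :
    z ∈ pg v n '' Icc 0 n ↔ ∃ k, Wbtw ℝ (v k) z (v (k+1)) := by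
  rw [pg_image v n hn]
  constructor
  · rintro ⟨k, _, h⟩; exact ⟨k, h⟩
  · rintro ⟨k, h⟩
    have hp : Function.Periodic v n := hper
    refine ⟨k % n, Nat.mod_lt _ hn, ?_⟩
    have e1 : v (k % n) = v k := hp.map_mod_nat k
    have e2 : v (k % n + 1) = v (k + 1) := by
      rw [← hp.map_mod_nat (k % n + 1), ← hp.map_mod_nat (k+1)]; simp
    rwa [e1, e2]

lemma lineMap_ne {x y : Pt} (h : x ≠ y) {s : ℝ} (hs : s < 1) : AffineMap.lineMap x y s ≠ y := by
  intro h2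
  have := AffineMap.lineMap_injective ℝ h (h2.trans (AffineMap.lineMap_apply_one (k := ℝ) x y).symm)
  linarith

lemma pg_jordan (v : ℕ → Pt) (n : ℕ) (hn : 0 < n) (hper : ∀ i, v (i + n) = v i)
    (hne : ∀ i, v i ≠ v (i+1))
    (hs : ∀ e f z, e < f → f < e + n → Wbtw ℝ (v e) z (v (e+1)) → Wbtw ℝ (v f) z (v (f+1)) →
      z ≠ v (e+1) → z ≠ v (f+1) → False) : IsJordanCurve (pg v n '' Icc 0 n) := by
  apply jordan_of_path _ _ (by exact_mod_cast hn) (pg_cont v n)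
  · rw [pg_eq v n 0 hn 0 (by simp) (by simp), pg_eq v n (n-1) (by omega) n
      (by exact_mod_cast Nat.sub_le _ _) (by have : n ≤ n - 1 + 1 := by omega
                                             exact_mod_cast this)]
    have : ((n - 1 : ℕ) : ℝ) = n - 1 := by rw [Nat.cast_sub hn]; simp
    rw [this, show n - 1 + 1 = n by omega]
    have := hper 0
    simp at this
    simp [this]
  · have key : ∀ t ∈ Ico (0:ℝ) n, ∀ t' ∈ Ico (0:ℝ) n, pg v n t = pg v n t' → ⌊t⌋₊ < ⌊t'⌋₊ → False := by
      intro t ht t' ht' h hlt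
      have a1 := Nat.floor_le ht.1
      have a2 := (Nat.lt_floor_add_one t)
      have b1 := Nat.floor_le ht'.1
      have b2 := (Nat.lt_floor_add_one t')
      have a3 := (Nat.floor_lt ht.1).2 ht.2
      have b3 := (Nat.floor_lt ht'.1).2 ht'.2
      refine hs ⌊t⌋₊ ⌊t'⌋₊ (pg v n t) hlt (by omega) ?_ ?_ ?_ ?_
      · rw [pg_eq v n _ a3 t a1 a2.le]; exact ⟨_, ⟨by linarith, by linarith⟩, rfl⟩
      · rw [h, pg_eq v n _ b3 t' b1 b2.le]; exact ⟨_, ⟨by linarith, by linarith⟩, rfl⟩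
      · rw [pg_eq v n _ a3 t a1 a2.le]; exact lineMap_ne (hne _) (by linarith)
      · rw [h, pg_eq v n _ b3 t' b1 b2.le]; exact lineMap_ne (hne _) (by linarith)
    intro t ht t' ht' h
    rcases lt_trichotomy ⌊t⌋₊ ⌊t'⌋₊ with h1 | h1 | h1
    · exact (key t ht t' ht' h h1).elim
    · have a1 := Nat.floor_le ht.1
      have a2 := (Nat.lt_floor_add_one t)
      have b1 := Nat.floor_le ht'.1
      have b2 := (Nat.lt_floor_add_one t')
      have a3 := (Nat.floor_lt ht.1).2 ht.2
      have b3 := (Nat.floor_lt ht'.1).2 ht'.2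
      rw [pg_eq v n _ a3 t a1 a2.le, pg_eq v n _ b3 t' b1 b2.le, h1] at h
      have := AffineMap.lineMap_injective ℝ (hne _) h
      linarith
    · exact (key t' ht' t ht h.symm h1).elim

lemma cci_seg {S : Set Pt} {x y : Pt} (h : segment ℝ x y ⊆ S) :
    connectedComponentIn S x = connectedComponentIn S y := by
  apply connectedComponentIn_eq
  exact (convex_segment x y).isPreconnected.subset_connectedComponentIn
    (left_mem_segment ℝ x y) h (right_mem_segment ℝ x y)

lemma line_seg {a b c : ℝ} {x y z : Pt} (hx : a * x.1 + b * x.2 = c) (hy : a * y.1 + b * y.2 = c)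
    (hz : z ∈ segment ℝ x y) : a * z.1 + b * z.2 = c := by
  obtain ⟨p, q, hp, hq, hpq, rfl⟩ := hz
  simp
  obtain rfl : p = 1 - q := by linarith
  linear_combination (1 - q) * hx + q * hy

lemma pg_exit (v : ℕ → Pt) (n : ℕ) (hn : 0 < n) (hper : ∀ i, v (i + n) = v i) (a b c : ℝ) (S : Set Pt)
    (hS : S = pg v n '' Icc 0 n ∩ {p : Pt | a * p.1 + b * p.2 = c})
    (r : ℕ) : ∀ i, ∀ z, Wbtw ℝ (v i) z (v (i+1)) → a * z.1 + b * z.2 = c →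
      a * (v (i + r + 1)).1 + b * (v (i + r + 1)).2 ≠ c →
      ∃ k w, Wbtw ℝ (v k) w (v (k+1)) ∧ a * w.1 + b * w.2 = c ∧
        a * (v (k+1)).1 + b * (v (k+1)).2 ≠ c ∧
        connectedComponentIn S z = connectedComponentIn S w := by
  induction r with
  | zero =>
    intro i z h1 h2 h3
    exact ⟨i, z, h1, h2, h3, rfl⟩
  | succ r ih =>
    intro i z h1 h2 h3
    by_cases h4 : a * (v (i+1)).1 + b * (v (i+1)).2 = c
    · obtain ⟨k, w, k1, k2, k3, k4⟩ := ih (i+1) (v (i+1)) (wbtw_self_left ℝ _ _) h4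
        (by rwa [show i + 1 + r + 1 = i + (r + 1) + 1 by omega])
      refine ⟨k, w, k1, k2, k3, ?_⟩
      rw [← k4]
      apply cci_seg
      intro p hp
      rw [hS]
      refine ⟨?_, line_seg h2 h4 hp⟩
      rw [pg_image' v n hn hper]
      refine ⟨i, ?_⟩
      have h5 : Wbtw ℝ z p (v (i+1)) := mem_segment_iff_wbtw.1 hp
      exact h1.trans_right h5
    · exact ⟨i, z, h1, h2, h4, rfl⟩

lemma wbtw_f {a b c : ℝ} {x y z : Pt} (h : Wbtw ℝ x z y) (hz : a * z.1 + b * z.2 = c)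
    : ∃ s, 0 ≤ s ∧ s ≤ 1 ∧ z = AffineMap.lineMap x y s ∧
      (1 - s) * (a * x.1 + b * x.2 - c) + s * (a * y.1 + b * y.2 - c) = 0 := by
  obtain ⟨s, hs, rfl⟩ := h
  refine ⟨s, hs.1, hs.2, rfl, ?_⟩
  rw [AffineMap.lineMap_apply] at hz
  simp at hz
  linarith

lemma pg_comps (v : ℕ → Pt) (n : ℕ) (hn : 0 < n) (hper : ∀ i, v (i + n) = v i) (a b c : ℝ) (d : ℕ)
    (hex : ∃ i, a * (v i).1 + b * (v i).2 ≠ c)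
    (hd : ((Finset.range n).filter fun k => a * (v (k+1)).1 + b * (v (k+1)).2 - c ≠ 0 ∧
        (a * (v k).1 + b * (v k).2 - c) * (a * (v (k+1)).1 + b * (v (k+1)).2 - c) ≤ 0).card ≤ d) :
    CompsLE (pg v n '' Icc 0 n ∩ {p : Pt | a * p.1 + b * p.2 = c}) d := by
  set S := pg v n '' Icc 0 n ∩ {p : Pt | a * p.1 + b * p.2 = c} with hS
  have hp : Function.Periodic v n := hper
  intro f hf
  have h1 : ∀ i, ∃ k < n, ∃ w, Wbtw ℝ (v k) w (v (k+1)) ∧ a * w.1 + b * w.2 = c ∧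
        a * (v (k+1)).1 + b * (v (k+1)).2 ≠ c ∧
        connectedComponentIn S (f i) = connectedComponentIn S w := by
    intro i
    obtain ⟨hz, hl⟩ := hf i
    rw [pg_image v n hn] at hz
    obtain ⟨k, hk, hw⟩ := hz
    obtain ⟨j, hj⟩ := hex
    have : ∃ r, a * (v (k + r + 1)).1 + b * (v (k + r + 1)).2 ≠ c := by
      refine ⟨j + (k + 1) * n - (k + 1), ?_⟩
      have h5 : k + (j + (k + 1) * n - (k + 1)) + 1 = j + (k+1) * n := by
        have : k + 1 ≤ (k+1) * n := Nat.le_mul_of_pos_right _ hn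
        omega
      rw [h5]
      have := hp.nat_mul (k+1) j
      simp only [Nat.cast_id] at this
      rwa [this]
    obtain ⟨r, hr⟩ := this
    obtain ⟨k, w, k1, k2, k3, k4⟩ := pg_exit v n hn hper a b c S hS r k (f i) hw hl hr
    have e1 : v (k % n) = v k := hp.map_mod_nat k
    have e2 : v (k % n + 1) = v (k + 1) := by
      rw [← hp.map_mod_nat (k % n + 1), ← hp.map_mod_nat (k+1)]; simp
    refine ⟨k % n, Nat.mod_lt _ hn, w, ?_, k2, ?_, k4⟩ <;> rw [e2]
    · rwa [e1]
    · exact k3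
  choose K hK w hw1 hw2 hw3 hw4 using h1
  obtain ⟨i, _, j, _, hij, hKij⟩ := Finset.exists_ne_map_eq_of_card_lt_of_maps_to
    (s := (Finset.univ : Finset (Fin (d+1)))) (f := K)
    (t := (Finset.range n).filter fun k => a * (v (k+1)).1 + b * (v (k+1)).2 - c ≠ 0 ∧
        (a * (v k).1 + b * (v k).2 - c) * (a * (v (k+1)).1 + b * (v (k+1)).2 - c) ≤ 0)
    (by rw [Finset.card_univ, Fintype.card_fin]; omega)
    (by
      intro i _
      simp only [Finset.coe_filter, Finset.mem_range]
      refine ⟨hK i, sub_ne_zero.2 (hw3 i), ?_⟩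
      obtain ⟨s, h0, h1, _, h3⟩ := wbtw_f (hw1 i) (hw2 i)
      by_contra! hcon
      set X := a * (v (K i)).1 + b * (v (K i)).2 - c
      set Y := a * (v (K i + 1)).1 + b * (v (K i + 1)).2 - c
      have h4 : (1 - s) * (X * Y) + s * Y ^ 2 = 0 := by linear_combination Y * h3
      have hY : 0 < Y ^ 2 := by have : Y ≠ 0 := right_ne_zero_of_mul hcon.ne'
                                positivity
      rcases h1.lt_or_eq with h | h
      · nlinarith [mul_pos (sub_pos.2 h) hcon, mul_nonneg h0 hY.le]
      · subst h; linarith)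
  refine ⟨i, j, hij, ?_⟩
  rw [hw4, hw4]
  congr 1
  obtain ⟨s, h0, h1, h2, h3⟩ := wbtw_f (hw1 i) (hw2 i)
  obtain ⟨s', h0', h1', h2', h3'⟩ := wbtw_f (hw1 j) (hw2 j)
  rw [h2, h2', ← hKij]
  rw [← hKij] at h3'
  have hne := hw3 i
  set X := a * (v (K i)).1 + b * (v (K i)).2 - c
  have hY : a * (v (K i + 1)).1 + b * (v (K i + 1)).2 - c ≠ 0 := sub_ne_zero.2 hne
  set Y := a * (v (K i + 1)).1 + b * (v (K i + 1)).2 - c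
  have : (s - s') * (Y - X) = 0 := by linear_combination h3 - h3'
  rcases mul_eq_zero.1 this with h | h
  · rw [sub_eq_zero.1 h]
  · exfalso; apply hY
    have : Y = X := by linarith
    rw [this] at h3; rw [this]; linarith

lemma exit_count (F : ℕ → ℝ) (n : ℕ) (h0 : F n = F 0) :
    2 * (((Finset.range n).filter fun k => F (k+1) ≠ 0 ∧ F k * F (k+1) ≤ 0).card : ℝ) =
      ∑ k ∈ Finset.range n, cut (fun k => 0 < F k) k (k+1) +
      ∑ k ∈ Finset.range n, cut (fun k => F k < 0) k (k+1) := by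
  have h1 := Finset.sum_range_sub (fun k => if F k = 0 then (1:ℝ) else 0) n
  rw [h0, sub_self] at h1
  rw [Finset.card_filter]
  push_cast
  refine (add_zero _).symm.trans ((congrArg _ h1.symm).trans ?_)
  rw [Finset.mul_sum, ← Finset.sum_add_distrib, ← Finset.sum_add_distrib]
  apply Finset.sum_congr rfl
  intro k _
  unfold cut
  rcases lt_trichotomy (F k) 0 with hx | hx | hx <;> rcases lt_trichotomy (F (k+1)) 0 with hy | hy | hy
  · have := mul_pos_of_neg_of_neg hx hy
    simp [hx, hy, hx.ne, hy.ne, hx.not_gt, hy.not_gt, this.not_ge]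
  · simp [hx, hy, hx.ne, hx.le]
  · have := mul_neg_of_neg_of_pos hx hy
    simp [hx, hy, hx.ne, hy.ne', this.le, hx.not_gt, hy.not_gt]; norm_num
  · simp [hx, hy, hy.ne, hy.le]; norm_num
  · simp [hx, hy]
  · simp [hx, hy, hy.ne', hy.le]; norm_num
  · have := mul_neg_of_pos_of_neg hx hy
    simp [hx, hy, hx.ne', hy.ne, this.le, hx.not_gt, hy.not_gt]; norm_num
  · simp [hx, hy, hx.ne', hx.le]
  · have := mul_pos hx hy
    simp [hx, hy, hx.ne', hy.ne', hx.not_gt, hy.not_gt, this.not_ge]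

theorem poly_jordan {V : Finset Pt} (hV : ¬ Collinear ℝ (V : Set Pt)) {N : ℝ} {l : List Pt}
    (hl : l ∈ TT V N) (hs : ∀ e f z, e < f → f < e + l.length →
      Wbtw ℝ (vt l e) z (vt l (e+1)) → Wbtw ℝ (vt l f) z (vt l (f+1)) →
      z ≠ vt l (e+1) → z ≠ vt l (f+1) → False) :
    ∃ J, IsJordanCurve J ∧ (∀ k, segment ℝ (vt l k) (vt l (k+1)) ⊆ J) ∧ StabLER J N := by
  obtain ⟨hnd, hlV, hcut⟩ := hl
  have hlen : 2 ≤ l.length := by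
    by_contra! h
    apply hV
    have hss : (V : Set Pt).Subsingleton → Collinear ℝ (V : Set Pt) := by
      intro h
      rcases h.eq_empty_or_singleton with h | ⟨x, h⟩ <;> rw [h]
      · exact collinear_empty ℝ Pt
      · exact collinear_singleton ℝ x
    apply hss
    have : V.card ≤ 1 := by rw [← hlV, List.toFinset_card_of_nodup hnd]; omega
    rw [Finset.card_le_one] at this
    intro x hx y hy
    exact this x hx y hy
  have hpos : 0 < l.length := by omega
  have hper : ∀ i, vt l (i + l.length) = vt l i := by intro i; simp [vt]
  have hne : ∀ i, vt l i ≠ vt l (i+1) := by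
    intro i hv
    rw [vt, vt, getElem!_pos l _ (Nat.mod_lt _ hpos), getElem!_pos l _ (Nat.mod_lt _ hpos)] at hv
    have h5 : i ≡ i + 1 [MOD l.length] := (List.Nodup.getElem_inj_iff hnd).1 hv
    have := (Nat.modEq_iff_dvd' (Nat.le_succ i)).1 h5
    have := Nat.le_of_dvd (by omega) this
    omega
  refine ⟨pg (vt l) l.length '' Icc 0 l.length, pg_jordan _ _ hpos hper hne hs, ?_, ?_⟩
  · intro k z hz
    rw [pg_image' _ _ hpos hper]
    exact ⟨k, mem_segment_iff_wbtw.1 hz⟩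
  · rintro _ ⟨a, b, c, hab, rfl⟩
    apply pg_comps _ _ hpos hper
    · by_contra! hcon
      apply hV
      rw [collinear_iff_exists_forall_eq_smul_vadd]
      refine ⟨vt l 0, (-b, a), ?_⟩
      intro p hp
      have hp' : p ∈ l := by
        rw [← List.mem_toFinset, hlV]; exact hp
      obtain ⟨i, hi, rfl⟩ := List.getElem_of_mem hp'
      have e1 : vt l i = l[i] := by
        rw [vt, Nat.mod_eq_of_lt hi, getElem!_pos l _ hi]
      have h0 := hcon 0
      have h1 := hcon i
      rw [e1] at h1
      set p := l[i]
      set q := vt l 0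
      have hab2 : a ^ 2 + b ^ 2 ≠ 0 := by
        rcases hab with h | h <;> positivity
      refine ⟨(a * (p.2 - q.2) - b * (p.1 - q.1)) / (a^2+b^2), ?_⟩
      ext
      · simp; field_simp; linear_combination a * h1 - a * h0
      · simp; field_simp; linear_combination b * h1 - b * h0
    · have h1 := exit_count (fun k => a * (vt l k).1 + b * (vt l k).2 - c) l.length (by simp [vt])
      apply Nat.le_floor
      have h2 := hcut a b c
      have h3 := hcut (-a) (-b) (-c)
      rw [cyc_sum] at h2 h3
      have e1 : ∀ i < l.length, l[i]! = vt l i := by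
        intro i hi; rw [vt, Nat.mod_eq_of_lt hi]
      have h4 : ∑ k ∈ Finset.range l.length, cut (fun k => 0 < a * (vt l k).1 + b * (vt l k).2 - c) k (k+1) ≤ N := by
        refine le_trans (le_of_eq ?_) h2
        apply Finset.sum_congr rfl
        intro k hk
        rw [Finset.mem_range] at hk
        rw [e1 k hk]
        simp [cut, HP, vt]
      have h5 : ∑ k ∈ Finset.range l.length, cut (fun k => a * (vt l k).1 + b * (vt l k).2 - c < 0) k (k+1) ≤ N := by
        refine le_trans (le_of_eq ?_) h3
        apply Finset.sum_congr rfl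
        intro k hk
        rw [Finset.mem_range] at hk
        rw [e1 k hk]
        have : ∀ x y : ℝ, -c < -x + -y ↔ x + y < c := fun x y => by constructor <;> intro h <;> linarith
        simp [cut, HP, vt, this]
      linarith

end Polygon

open Set

noncomputable section Orders
open Classical

lemma cyc_map_range {α : Type*} [Inhabited α] (c : α → α → ℝ) (g : ℕ → α) (n : ℕ) (hg : g n = g 0) :
    cyc c ((List.range n).map g) = ∑ k ∈ Finset.range n, c (g k) (g (k+1)) := by
  rw [cyc_sum]
  simp only [List.length_map, List.length_range]
  apply Finset.sum_congr rfl
  intro k hk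
  rw [Finset.mem_range] at hk
  have h1 : (k + 1) % n < n := Nat.mod_lt _ (by omega)
  rw [getElem!_pos _ _ (by simpa using hk), getElem!_pos _ _ (by simpa using h1)]
  simp only [List.getElem_map, List.getElem_range]
  rcases Nat.lt_or_ge (k+1) n with h | h
  · rw [Nat.mod_eq_of_lt h]
  · have : k + 1 = n := by omega
    rw [this, Nat.mod_self, hg]

lemma order_one (A : Finset Pt) (hA : A.Nonempty) (B : Set Pt) (hB : IsJordanCurve B)
    (hAB : (A : Set Pt) ⊆ B) : ∃ (γ : ℝ → Pt) (n : ℕ) (τ : ℕ → ℝ), Continuous γ ∧ γ 0 = γ 1 ∧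
      InjOn γ (Ico 0 1) ∧ B = γ '' Icc 0 1 ∧ τ 0 = 0 ∧ τ n = 1 ∧
      (∀ i j, i < j → j ≤ n → τ i < τ j) ∧ A = (Finset.range n).image (fun k => γ (τ k)) := by
  obtain ⟨p, hp⟩ := hA
  obtain ⟨γ, hc, h0, h1, hi, rfl⟩ := path_of_jordan B hB p (hAB hp)
  have hpar : ∀ q : A, ∃ t ∈ Ico (0:ℝ) 1, γ t = q := by
    intro ⟨q, hq⟩
    obtain ⟨t, ht, rfl⟩ := hAB hq
    rcases eq_or_lt_of_le ht.2 with h | h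
    · refine ⟨0, by simp, ?_⟩
      simp only; rw [h, h0, h1]
    · exact ⟨t, ⟨ht.1, h⟩, rfl⟩
  choose t ht htq using hpar
  let T : Finset ℝ := Finset.univ.image t
  have hT : ∀ x ∈ T, x ∈ Ico (0:ℝ) 1 := by
    intro x hx
    obtain ⟨q, _, rfl⟩ := Finset.mem_image.1 hx
    exact ht q
  have hT0 : (0:ℝ) ∈ T := by
    refine Finset.mem_image.2 ⟨⟨p, hp⟩, Finset.mem_univ _, ?_⟩
    apply hi (ht _) (by simp)
    rw [htq, h0]
  have hcp : 0 < T.card := Finset.card_pos.2 ⟨0, hT0⟩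
  let e := T.orderEmbOfFin rfl
  let τ : ℕ → ℝ := fun k => if h : k < T.card then e ⟨k, h⟩ else 1
  have hmem : ∀ k < T.card, τ k ∈ T := by
    intro k hk
    simp only [τ]; rw [dif_pos hk]
    exact T.orderEmbOfFin_mem rfl _
  refine ⟨γ, T.card, τ, hc, by rw [h0, h1], hi, rfl, ?_, by simp [τ], ?_, ?_⟩
  · have := Finset.orderEmbOfFin_zero (s := T) rfl hcp
    simp only [τ]; rw [dif_pos hcp]
    apply le_antisymm
    · rw [this]; exact Finset.min'_le _ _ hT0
    · exact (hT _ (T.orderEmbOfFin_mem rfl _)).1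
  · intro i j hij hj
    rcases eq_or_lt_of_le hj with h | h
    · have : τ j = 1 := by simp [τ, h]
      rw [this]
      exact (hT _ (hmem i (by omega))).2
    · simp only [τ]; rw [dif_pos h, dif_pos (hij.trans h)]
      exact e.strictMono (by simpa using hij)
  · ext q; constructor
    · intro hq
      have : t ⟨q, hq⟩ ∈ T := Finset.mem_image_of_mem _ (Finset.mem_univ _)
      have h5 : t ⟨q, hq⟩ ∈ Set.range e := by rw [T.range_orderEmbOfFin rfl]; exact this
      obtain ⟨k, hk⟩ := h5
      refine Finset.mem_image.2 ⟨k, by simp, ?_⟩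
      simp only [τ]; rw [dif_pos k.2, Fin.eta, hk, htq]
    · intro hq
      obtain ⟨k, hk, rfl⟩ := Finset.mem_image.1 hq
      rw [Finset.mem_range] at hk
      obtain ⟨q, _, hq⟩ := Finset.mem_image.1 (hmem k hk)
      rw [← hq, htq]; exact q.2

lemma exists_shift (W : Finset ℝ) (c : ℝ) : ∃ c', c < c' ∧ ∀ x ∈ W, x ≠ c' ∧ (c < x ↔ c' < x) := by
  let U := W.filter fun x => c < x
  rcases U.eq_empty_or_nonempty with h | h
  · have h1 : ∀ x ∈ W, x ≤ c := by
      intro x hx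
      by_contra! h2
      have : x ∈ U := Finset.mem_filter.2 ⟨hx, h2⟩
      rw [h] at this; simp at this
    refine ⟨c + 1, by linarith, fun x hx => ?_⟩
    have := h1 x hx
    refine ⟨by linarith, ?_⟩
    constructor <;> intro <;> linarith
  · have h1 := Finset.mem_filter.1 (Finset.min'_mem U h)
    refine ⟨(c + U.min' h) / 2, by linarith, fun x hx => ?_⟩
    by_cases h2 : c < x
    · have := Finset.min'_le U x (Finset.mem_filter.2 ⟨hx, h2⟩)
      refine ⟨by linarith, ?_⟩
      constructor <;> intro <;> linarith
    · refine ⟨by linarith, ?_⟩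
      constructor <;> intro <;> linarith

lemma cyc_const_zero {α : Type*} [Inhabited α] (P : α → Prop) (l : List α) (h : ∀ x ∈ l, ∀ y ∈ l, P x ↔ P y) :
    cyc (cut P) l = 0 := by
  apply le_antisymm
  · have := cyc_congr_le (cut P) (fun _ _ => 0) l (by
      intro u hu v hv
      simp [cut, h u hu v hv])
    refine this.trans ?_
    rw [cyc_sum]; simp
  · rw [cyc_sum]; exact Finset.sum_nonneg fun i _ => cut_nonneg _ _ _

lemma cross_zero (γ : ℝ → Pt) (hc : Continuous γ) (a b c x y : ℝ) (hxy : x < y)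
    (hx : a * (γ x).1 + b * (γ x).2 ≠ c) (hy : a * (γ y).1 + b * (γ y).2 ≠ c)
    (h : ¬ (HP a b c (γ x) ↔ HP a b c (γ y))) : ∃ t ∈ Ioo x y, a * (γ t).1 + b * (γ t).2 = c := by
  have hf : ContinuousOn (fun t => a * (γ t).1 + b * (γ t).2) (Icc x y) := by fun_prop
  unfold HP at h
  by_cases h1 : c < a * (γ x).1 + b * (γ x).2
  · have h2 : a * (γ y).1 + b * (γ y).2 < c := by
      rcases lt_or_gt_of_ne hy with h3 | h3
      · exact h3
      · exact absurd (iff_of_true h1 h3) h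
    exact intermediate_value_Ioo' hxy.le hf ⟨h2, h1⟩
  · have h2 : c < a * (γ y).1 + b * (γ y).2 := by
      by_contra h3
      exact h (iff_of_false h1 h3)
    have h4 : a * (γ x).1 + b * (γ x).2 < c := lt_of_le_of_ne (not_lt.1 h1) hx
    exact intermediate_value_Ioo hxy.le hf ⟨h4, h2⟩

theorem orders {ι : Type*} [Fintype ι] (A : ι → Finset Pt) (B : ι → Set Pt)
    (hA : ∀ i, (A i).Nonempty) (hdis : ∀ i j, i ≠ j → Disjoint (B i) (B j))
    (hB : ∀ i, IsJordanCurve (B i)) (hAB : ∀ i, (A i : Set Pt) ⊆ B i) (d : ℕ)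
    (hd : ∀ l, IsAffLine l → CompsLE ((⋃ i, B i) ∩ l) d) :
    ∃ L : ι → List Pt, (∀ i, (L i).Nodup ∧ (L i).toFinset = A i) ∧
      ∀ a b c, ∑ i, cyc (cut (HP a b c)) (L i) ≤ d := by
  choose γ n τ hc h01 hinj hBi hτ0 hτ1 hmono hAi using
    fun i => order_one (A i) (hA i) (B i) (hB i) (hAB i)
  have hτI : ∀ i k, k < n i → τ i k ∈ Ico (0:ℝ) 1 := by
    intro i k hk
    constructor
    · rcases Nat.eq_zero_or_pos k with rfl | h
      · exact (hτ0 i).ge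
      · rw [← hτ0 i]; exact (hmono i 0 k h hk.le).le
    · rw [← hτ1 i]; exact hmono i k _ hk le_rfl
  have hτA : ∀ i k, k < n i → γ i (τ i k) ∈ A i := by
    intro i k hk
    rw [hAi i]; exact Finset.mem_image.2 ⟨k, Finset.mem_range.2 hk, rfl⟩
  have hnpos : ∀ i, 0 < n i := by
    intro i
    by_contra! h
    have h2 := hτ1 i
    rw [Nat.le_zero.1 h, hτ0 i] at h2
    norm_num at h2
  have hτA' : ∀ i k, k ≤ n i → γ i (τ i k) ∈ A i := by
    intro i k hk
    rcases eq_or_lt_of_le hk with h | h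
    · rw [h, hτ1, ← h01, ← hτ0 i]; exact hτA i 0 (hnpos i)
    · exact hτA i k h
  have hBclosed : ∀ i, IsClosed (B i) := by
    intro i; rw [hBi i]; exact (isCompact_Icc.image (hc i)).isClosed
  refine ⟨fun i => (List.range (n i)).map fun k => γ i (τ i k), ?_, ?_⟩
  · intro i
    constructor
    · refine (List.nodup_range).map_on ?_
      intro x hx y hy hxy
      rw [List.mem_range] at hx hy
      have h := hinj i (hτI i x hx) (hτI i y hy) hxy
      rcases lt_trichotomy x y with h1 | h1 | h1
      · exact absurd h (hmono i x y h1 hy.le).ne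
      · exact h1
      · exact absurd h (hmono i y x h1 hx.le).ne'
    · rw [hAi i]; ext q; simp
  intro a b c
  by_cases hab : a = 0 ∧ b = 0
  · rw [Finset.sum_eq_zero]
    · positivity
    · intro i _
      apply cyc_const_zero
      intro x _ y _
      simp [HP, hab.1, hab.2]
  have hab' : a ≠ 0 ∨ b ≠ 0 := by tauto
  obtain ⟨c', hcc, hc'⟩ := exists_shift
    ((Finset.univ.biUnion A).image fun p => a * p.1 + b * p.2) c
  have hsh : ∀ i, ∀ p ∈ A i, a * p.1 + b * p.2 ≠ c' ∧ (HP a b c p ↔ HP a b c' p) := by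
    intro i p hp
    exact hc' _ (Finset.mem_image.2 ⟨p, Finset.mem_biUnion.2 ⟨i, Finset.mem_univ _, hp⟩, rfl⟩)
  set S := (⋃ i, B i) ∩ {p : Pt | a * p.1 + b * p.2 = c'} with hS
  let E : Finset (Σ _ : ι, ℕ) := Finset.univ.sigma fun i => (Finset.range (n i)).filter fun k =>
    ¬ (HP a b c' (γ i (τ i k)) ↔ HP a b c' (γ i (τ i (k+1))))
  have hcard : ∑ i, cyc (cut (HP a b c)) ((List.range (n i)).map fun k => γ i (τ i k)) = (E.card : ℝ) := by
    rw [Finset.card_sigma]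
    push_cast
    apply Finset.sum_congr rfl
    intro i _
    rw [cyc_map_range _ _ _ (by rw [hτ1, hτ0, h01]), Finset.card_filter]
    push_cast
    apply Finset.sum_congr rfl
    intro k hk
    rw [Finset.mem_range] at hk
    unfold cut
    rw [(hsh i _ (hτA i k hk)).2, (hsh i _ (hτA' i (k+1) hk)).2]
    split_ifs <;> simp_all
  rw [hcard]
  norm_cast
  by_contra! hlt
  have hz : ∀ e ∈ E, ∃ t ∈ Ioo (τ e.1 e.2) (τ e.1 (e.2+1)), a * (γ e.1 t).1 + b * (γ e.1 t).2 = c' := by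
    intro ⟨i, k⟩ he
    simp only [E, Finset.mem_sigma, Finset.mem_filter, Finset.mem_range] at he
    exact cross_zero (γ i) (hc i) a b c' _ _ (hmono i k (k+1) (by omega) he.2.1)
      (hsh i _ (hτA i k he.2.1)).1 (hsh i _ (hτA' i (k+1) he.2.1)).1 he.2.2
  choose! t ht htz using hz
  have hEk : ∀ e ∈ E, e.2 < n e.1 := by
    intro ⟨i, k⟩ he
    simp only [E, Finset.mem_sigma, Finset.mem_filter, Finset.mem_range] at he
    exact he.2.1
  have htI : ∀ e ∈ E, t e ∈ Ioo (0:ℝ) 1 := by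
    intro e he
    have h1 := ht e he
    have h2 := (hτI e.1 e.2 (hEk e he)).1
    have h3 : τ e.1 (e.2+1) ≤ 1 := by
      rcases eq_or_lt_of_le (Nat.succ_le_of_lt (hEk e he)) with h | h
      · have : e.2 + 1 = n e.1 := h
        rw [this, hτ1]
      · exact (hτI e.1 _ h).2.le
    exact ⟨by linarith [h1.1], by linarith [h1.2]⟩
  have hzB : ∀ e ∈ E, γ e.1 (t e) ∈ B e.1 := by
    intro e he
    rw [hBi]
    exact ⟨t e, Ioo_subset_Icc_self (htI e he), rfl⟩
  have hzS : ∀ e ∈ E, γ e.1 (t e) ∈ S := fun e he => ⟨mem_iUnion.2 ⟨e.1, hzB e he⟩, htz e he⟩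
  have hother : ∀ i, IsClosed (⋃ j : {j // j ≠ i}, B j.1) := fun i =>
    isClosed_iUnion_of_finite fun j => hBclosed _
  have hcov : ∀ i, (⋃ j, B j) ⊆ B i ∪ (⋃ j : {j // j ≠ i}, B j.1) := by
    intro i p hp
    obtain ⟨j, hj⟩ := mem_iUnion.1 hp
    by_cases h : j = i
    · left; rwa [← h]
    · right; exact mem_iUnion.2 ⟨⟨j, h⟩, hj⟩
  have hdis' : ∀ i p, p ∈ B i → p ∈ (⋃ j : {j // j ≠ i}, B j.1) → False := by
    intro i p h1 h2
    obtain ⟨j, hj⟩ := mem_iUnion.1 h2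
    exact (Set.disjoint_left.1 (hdis i j.1 j.2.symm)) h1 hj
  -- two crossing edges on the same curve
  have same : ∀ i k k' (h : (⟨i, k⟩ : Σ _ : ι, ℕ) ∈ E) (h' : (⟨i, k'⟩ : Σ _ : ι, ℕ) ∈ E), k < k' →
      connectedComponentIn S (γ i (t ⟨i, k⟩)) = connectedComponentIn S (γ i (t ⟨i, k'⟩)) → False := by
    intro i k k' h h' hkk heq
    have hk' := hEk _ h'
    simp only at hk'
    have hkn : k + 1 < n i := by omega
    have htb := hτI i (k+1) hkn
    have ht1 := ht _ h
    have ht2 := ht _ h'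
    have hle : τ i (k+1) ≤ τ i k' := by
      rcases eq_or_lt_of_le (Nat.succ_le_of_lt hkk) with h | h
      · exact le_of_eq (congrArg _ h)
      · exact (hmono i _ _ h hk'.le).le
    simp only at ht1 ht2
    have hpre := isPreconnected_closed_iff.1 (isPreconnected_connectedComponentIn
      (F := S) (x := γ i (t ⟨i, k⟩))) (γ i '' Icc 0 (τ i (k+1)))
      (γ i '' Icc (τ i (k+1)) 1 ∪ ⋃ j : {j // j ≠ i}, B j.1)
      ((isCompact_Icc.image (hc i)).isClosed)
      (((isCompact_Icc.image (hc i)).isClosed).union (hother i))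
      (by
        intro p hp
        have hp2 := connectedComponentIn_subset _ _ hp
        rcases hcov i hp2.1 with h3 | h3
        · rw [hBi i] at h3
          obtain ⟨x, hx, rfl⟩ := h3
          rcases le_total x (τ i (k+1)) with h4 | h4
          · left; exact ⟨x, ⟨hx.1, h4⟩, rfl⟩
          · right; left; exact ⟨x, ⟨h4, hx.2⟩, rfl⟩
        · right; right; exact h3)
      ⟨_, mem_connectedComponentIn (hzS _ h), ⟨_, ⟨(htI _ h).1.le, ht1.2.le⟩, rfl⟩⟩
      ⟨γ i (t ⟨i, k'⟩), by rw [heq]; exact mem_connectedComponentIn (hzS _ h'),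
        Or.inl ⟨_, ⟨by linarith [ht2.1], (htI _ h').2.le⟩, rfl⟩⟩
    obtain ⟨q, hqC, ⟨x, hx, rfl⟩, hq2⟩ := hpre
    have hql : a * (γ i x).1 + b * (γ i x).2 = c' := (connectedComponentIn_subset _ _ hqC).2
    rcases hq2 with ⟨y, hy, hyx⟩ | hq2
    · rcases eq_or_lt_of_le hy.2 with h1 | h1
      · have : x = 0 := by
          apply hinj i ⟨hx.1, by linarith [hx.2, htb.2]⟩ (by simp)
          rw [h01 i, ← h1, hyx]
        rw [this, ← hτ0 i] at hql
        exact (hsh i _ (hτA i 0 (hnpos i))).1 hql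
      · have : x = y := by
          apply hinj i ⟨hx.1, by linarith [hx.2, htb.2]⟩ ⟨by linarith [hy.1, htb.1], h1⟩ hyx.symm
        have : x = τ i (k+1) := le_antisymm hx.2 (by rw [this]; exact hy.1)
        rw [this] at hql
        exact (hsh i _ (hτA i _ hkn)).1 hql
    · apply hdis' i (γ i x) _ hq2
      rw [hBi i]; exact ⟨x, ⟨hx.1, by linarith [hx.2, htb.2]⟩, rfl⟩
  have diff : ∀ e ∈ E, ∀ e' ∈ E, e.1 ≠ e'.1 →
      connectedComponentIn S (γ e.1 (t e)) = connectedComponentIn S (γ e'.1 (t e')) → False := by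
    intro e he e' he' hne heq
    have hpre := isPreconnected_closed_iff.1 (isPreconnected_connectedComponentIn
      (F := S) (x := γ e.1 (t e))) (B e.1) (⋃ j : {j // j ≠ e.1}, B j.1) (hBclosed _) (hother _)
      (fun p hp => hcov _ (connectedComponentIn_subset _ _ hp).1)
      ⟨_, mem_connectedComponentIn (hzS _ he), hzB e he⟩
      ⟨γ e'.1 (t e'), by rw [heq]; exact mem_connectedComponentIn (hzS _ he'),
        mem_iUnion.2 ⟨⟨e'.1, hne.symm⟩, hzB e' he'⟩⟩
    obtain ⟨q, _, h1, h2⟩ := hpre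
    exact hdis' _ q h1 h2
  obtain ⟨φ⟩ : Nonempty (Fin (d+1) ↪ E) := by
    apply Function.Embedding.nonempty_of_card_le
    simp; omega
  obtain ⟨i, j, hij, hcomp⟩ := hd _ ⟨a, b, c', hab', rfl⟩
    (fun i => γ (φ i).1.1 (t (φ i).1)) (fun i => hzS _ (φ i).2)
  have hφ : (φ i).1 ≠ (φ j).1 := fun h => hij (φ.injective (Subtype.ext h))
  have hi := (φ i).2
  have hj := (φ j).2
  generalize (φ i).1 = e at *
  generalize (φ j).1 = e' at *
  obtain ⟨i1, k1⟩ := e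
  obtain ⟨i2, k2⟩ := e'
  by_cases h : i1 = i2
  · subst h
    rcases lt_trichotomy k1 k2 with h1 | h1 | h1
    · exact same i1 k1 k2 hi hj h1 hcomp
    · exact hφ (by rw [h1])
    · exact same i1 k2 k1 hj hi h1 hcomp.symm
  · exact diff _ hi _ hj h hcomp

end Orders

open Set

section EdgeLemma
variable {α : Type*} [DecidableEq α]

/-- number of unit distance edges in direction j -/
def es (F : Finset (Finset α)) (j : α) : ℕ := (F.filter fun B => j ∉ B ∧ insert j B ∈ F).card

lemma es_split (F : Finset (Finset α)) (a j : α) (h : j ≠ a) :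
    es F j = es (F.memberSubfamily a) j + es (F.nonMemberSubfamily a) j := by
  unfold es
  rw [← Finset.card_memberSubfamily_add_card_nonMemberSubfamily a (F.filter fun B => j ∉ B ∧ insert j B ∈ F)]
  congr 2
  · ext B
    simp only [Finset.mem_memberSubfamily, Finset.mem_filter, Finset.mem_insert, not_or,
      Finset.insert_comm a j]
    have := Ne.symm h
    tauto
  · ext B
    simp only [Finset.mem_nonMemberSubfamily, Finset.mem_filter, Finset.mem_insert, not_or]
    have := Ne.symm h
    tauto

lemma es_top (F : Finset (Finset α)) (a : α) :
    es F a = (F.memberSubfamily a ∩ F.nonMemberSubfamily a).card := by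
  unfold es
  congr 1
  ext B
  simp only [Finset.mem_memberSubfamily, Finset.mem_nonMemberSubfamily, Finset.mem_filter,
    Finset.mem_inter]
  tauto

lemma es_super (F G : Finset (Finset α)) (j : α) : es F j + es G j ≤ es (F ∪ G) j + es (F ∩ G) j := by
  unfold es
  rw [← Finset.card_union_add_card_inter]
  apply Nat.add_le_add <;> apply Finset.card_le_card <;> intro B <;>
    simp only [Finset.mem_union, Finset.mem_inter, Finset.mem_filter] <;> tauto

lemma shatters_union_sub (F : Finset (Finset α)) (a : α) (T : Finset α)
    (h : (F.memberSubfamily a ∪ F.nonMemberSubfamily a).Shatters T) : F.Shatters T := by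
  intro t ht
  have haT : a ∉ T := by
    intro ha
    obtain ⟨u, hu, h2⟩ := h (Finset.Subset.refl T)
    have : a ∈ u := by rw [← h2] at ha; exact (Finset.mem_inter.1 ha).2
    simp only [Finset.mem_union, Finset.mem_memberSubfamily, Finset.mem_nonMemberSubfamily] at hu
    tauto
  obtain ⟨u, hu, h2⟩ := h ht
  rcases Finset.mem_union.1 hu with hu | hu
  · rw [Finset.mem_memberSubfamily] at hu
    exact ⟨_, hu.1, by rw [Finset.inter_insert_of_notMem haT, h2]⟩
  · rw [Finset.mem_nonMemberSubfamily] at hu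
    exact ⟨u, hu.1, h2⟩

lemma shatters_inter_sub (F : Finset (Finset α)) (a : α) (T : Finset α)
    (h : (F.memberSubfamily a ∩ F.nonMemberSubfamily a).Shatters T) :
    a ∉ T ∧ F.Shatters (insert a T) := by
  have haT : a ∉ T := by
    intro ha
    obtain ⟨u, hu, h2⟩ := h (Finset.Subset.refl T)
    have : a ∈ u := by rw [← h2] at ha; exact (Finset.mem_inter.1 ha).2
    simp only [Finset.mem_inter, Finset.mem_memberSubfamily, Finset.mem_nonMemberSubfamily] at hu
    tauto
  refine ⟨haT, ?_⟩
  intro t ht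
  rw [Finset.subset_insert_iff] at ht
  obtain ⟨u, hu, h2⟩ := h ht
  simp only [Finset.mem_inter, Finset.mem_memberSubfamily, Finset.mem_nonMemberSubfamily] at hu
  by_cases ha : a ∈ t
  · refine ⟨_, hu.1.1, ?_⟩
    rw [← Finset.insert_inter_distrib, h2, Finset.insert_erase ha]
  · refine ⟨u, hu.2.1, ?_⟩
    rw [Finset.insert_inter_of_notMem hu.1.2, h2, Finset.erase_eq_self.2 ha]

lemma edge_lemma (U : Finset α) : ∀ (F : Finset (Finset α)) (d : ℕ), (∀ B ∈ F, B ⊆ U) →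
    (∀ T, F.Shatters T → T.card ≤ d) → ∑ j ∈ U, es F j ≤ d * F.card := by
  induction U using Finset.induction_on with
  | empty => intro F d _ _; simp
  | insert a U haU ih =>
    intro F d hF hd
    rw [Finset.sum_insert haU, es_top]
    set F1 := F.memberSubfamily a with hF1
    set F0 := F.nonMemberSubfamily a with hF0
    have h1 : ∑ j ∈ U, es F j ≤ ∑ j ∈ U, es (F1 ∪ F0) j + ∑ j ∈ U, es (F1 ∩ F0) j := by
      rw [← Finset.sum_add_distrib]
      apply Finset.sum_le_sum
      intro j hj
      rw [es_split F a j (by rintro rfl; exact haU hj)]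
      exact es_super _ _ _
    have hs1 : ∀ B ∈ F1 ∪ F0, B ⊆ U := by
      intro B hB
      rcases Finset.mem_union.1 hB with hB | hB
      · rw [hF1, Finset.mem_memberSubfamily] at hB
        have := hF _ hB.1
        exact (Finset.insert_subset_insert_iff hB.2).1 this
      · rw [hF0, Finset.mem_nonMemberSubfamily] at hB
        exact (Finset.subset_insert_iff_of_notMem hB.2).1 (hF _ hB.1)
    have h2 := ih (F1 ∪ F0) d hs1 (fun T hT => hd T (shatters_union_sub F a T hT))
    have hs2 : ∀ B ∈ F1 ∩ F0, B ⊆ U := fun B hB =>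
      hs1 B (Finset.mem_union_left _ (Finset.mem_inter.1 hB).1)
    have hc : F.card = (F1 ∪ F0).card + (F1 ∩ F0).card := by
      rw [Finset.card_union_add_card_inter, Finset.card_memberSubfamily_add_card_nonMemberSubfamily]
    rcases Nat.eq_zero_or_pos d with rfl | hdp
    · have hem : F1 ∩ F0 = ∅ := by
        by_contra hne
        have h3 : (F1 ∩ F0).Shatters ∅ := Finset.shatters_empty.2 (Finset.nonempty_iff_ne_empty.2 hne)
        have := hd _ (shatters_inter_sub F a ∅ h3).2
        simp at this
      have h3 : ∑ j ∈ U, es (F1 ∩ F0) j = 0 := by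
        rw [hem]; simp [es]
      rw [h3] at h1
      rw [hem]; simp at h2 ⊢
      intro i hi
      have := Finset.sum_eq_zero_iff.1 (le_antisymm (by simpa [Finset.sum_eq_zero h2] using h1) (Nat.zero_le _))
      exact this i hi
    · obtain ⟨e, rfl⟩ : ∃ e, d = e + 1 := ⟨d - 1, by omega⟩
      have h3 := ih (F1 ∩ F0) e hs2 (fun T hT => by
        obtain ⟨k1, k2⟩ := shatters_inter_sub F a T hT
        have := hd _ k2
        rw [Finset.card_insert_of_notMem k1] at this
        omega)
      rw [hc]
      nlinarith

lemma layer_cake [Fintype α] (f : Finset α → ℕ) (d : ℕ)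
    (hd : ∀ T, (Finset.univ.filter fun B => 0 < f B).Shatters T → T.card ≤ d) :
    ∑ j, ∑ B ∈ Finset.univ.filter (fun B : Finset α => j ∉ B), min (f B) (f (insert j B)) ≤ d * ∑ B, f B := by
  set M := ∑ B, f B
  have hM : ∀ B, f B ≤ M := fun B => Finset.single_le_sum (f := f) (fun _ _ => Nat.zero_le _) (Finset.mem_univ B)
  have hx : ∀ x ≤ M, x = ∑ t ∈ Finset.range M, if t < x then 1 else 0 := by
    intro x hx
    rw [← Finset.card_filter]
    have : (Finset.range M).filter (fun t => t < x) = Finset.range x := by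
      ext t; simp; omega
    rw [this, Finset.card_range]
  let F : ℕ → Finset (Finset α) := fun t => Finset.univ.filter fun B => t < f B
  have h1 : ∑ j, ∑ B ∈ Finset.univ.filter (fun B : Finset α => j ∉ B), min (f B) (f (insert j B))
      = ∑ t ∈ Finset.range M, ∑ j, es (F t) j := by
    rw [Finset.sum_comm (s := Finset.range M)]
    apply Finset.sum_congr rfl
    intro j _
    have h2 : ∀ t, es (F t) j = ∑ B ∈ Finset.univ.filter (fun B : Finset α => j ∉ B),
        if t < min (f B) (f (insert j B)) then 1 else 0 := by
      intro t
      rw [← Finset.card_filter]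
      unfold es
      congr 1
      ext B
      simp [F]; tauto
    simp_rw [h2]
    rw [Finset.sum_comm]
    apply Finset.sum_congr rfl
    intro B _
    exact hx _ ((min_le_left _ _).trans (hM B))
  have h3 : M = ∑ t ∈ Finset.range M, (F t).card := by
    have : ∀ t, (F t).card = ∑ B, if t < f B then 1 else 0 := fun t => by rw [← Finset.card_filter]
    simp_rw [this]
    rw [Finset.sum_comm]
    exact Finset.sum_congr rfl fun B _ => hx _ (hM B)
  rw [h1]
  calc ∑ t ∈ Finset.range M, ∑ j, es (F t) j ≤ ∑ t ∈ Finset.range M, d * (F t).card := by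
        apply Finset.sum_le_sum
        intro t _
        apply edge_lemma _ _ _ (fun B _ => Finset.subset_univ B)
        intro T hT
        apply hd T
        refine hT.mono_left ?_
        intro B hB
        simp [F] at hB ⊢
        omega
    _ = d * M := by rw [← Finset.mul_sum, ← h3]

lemma sauer_pow [Fintype α] (F : Finset (Finset α)) (d : ℕ) (hd : ∀ T, F.Shatters T → T.card ≤ d) :
    F.card ≤ (Fintype.card α + 1) ^ d := by
  have h1 : F.vcDim ≤ d := Finset.sup_le fun T hT => hd T (Finset.mem_shatterer.1 hT)
  refine (Finset.card_le_card_shatterer F).trans (Finset.card_shatterer_le_sum_vcDim.trans ?_)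
  calc ∑ k ∈ Finset.Iic F.vcDim, (Fintype.card α).choose k
      ≤ ∑ k ∈ Finset.range (d+1), (Fintype.card α).choose k := by
        apply Finset.sum_le_sum_of_subset
        intro k hk
        simp at hk ⊢; omega
    _ ≤ ∑ k ∈ Finset.range (d+1), (Fintype.card α) ^ k * 1 ^ (d - k) * d.choose k := by
        apply Finset.sum_le_sum
        intro k hk
        rw [Finset.mem_range] at hk
        have := Nat.choose_le_pow (Fintype.card α) k
        have h2 : 1 ≤ d.choose k := Nat.choose_pos (by omega)
        rw [one_pow, mul_one]
        nlinarith [Nat.zero_le ((Fintype.card α)^k)]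
    _ = _ := by rw [add_pow]; simp

end EdgeLemma

open Set

noncomputable section Packing
open Classical

/-- number of cuts separating two points -/
def sp {X ι : Type*} [Fintype ι] (S : ι → X → Prop) (x y : X) : ℕ :=
  (Finset.univ.filter fun i => ¬ (S i x ↔ S i y)).card

/-- dual shatter condition: no three cuts realize all patterns -/
def DualTwo {X ι : Type*} (S : ι → X → Prop) : Prop :=
  ∀ i : Fin 3 → ι, ∃ e : Fin 3 → Prop, ∀ x, ¬ ∀ k, (S (i k) x ↔ e k)

lemma class_lemma {X ι : Type*} [Fintype ι] (S : ι → X → Prop) (K : Finset X) (θ : ℝ) (hθ : 0 ≤ θ)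
    (hsep : ∀ x ∈ K, ∀ y ∈ K, x ≠ y → θ ≤ sp S x y) :
    ((K.card : ℝ) - 1) * θ / 2 ≤
      ∑ i, ((min (K.filter fun x => ¬ S i x).card (K.filter fun x => S i x).card : ℕ) : ℝ) := by
  rcases K.eq_empty_or_nonempty with rfl | hK
  · have h0 : (((∅ : Finset X).card : ℝ) - 1) * θ / 2 ≤ 0 := by
      rw [Finset.card_empty]; push_cast; linarith
    exact h0.trans (Finset.sum_nonneg fun i _ => Nat.cast_nonneg _)
  have hb : (0:ℝ) < K.card := by exact_mod_cast Finset.card_pos.2 hK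
  let p : ι → ℕ := fun i => (K.filter fun x => S i x).card
  let q : ι → ℕ := fun i => (K.filter fun x => ¬ S i x).card
  have hpq : ∀ i, p i + q i = K.card := fun i => Finset.card_filter_add_card_filter_not _
  have h1 : ∑ x ∈ K, ∑ y ∈ K, sp S x y = ∑ i, 2 * (p i * q i) := by
    have e1 : ∀ x y, sp S x y = ∑ i, if ¬ (S i x ↔ S i y) then 1 else 0 := by
      intro x y; unfold sp; rw [Finset.card_filter]
    simp_rw [e1]
    have e2 : ∀ x, ∑ y ∈ K, ∑ i, (if ¬ (S i x ↔ S i y) then 1 else 0) =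
      ∑ i, ∑ y ∈ K, (if ¬ (S i x ↔ S i y) then 1 else 0) := fun x => Finset.sum_comm
    simp_rw [e2]
    rw [Finset.sum_comm]
    apply Finset.sum_congr rfl
    intro i _
    have e3 : ∀ x, (∑ y ∈ K, if ¬ (S i x ↔ S i y) then 1 else 0) = if S i x then q i else p i := by
      intro x
      by_cases h : S i x
      · simp only [h, p, q, true_iff, if_true]; rw [Finset.card_filter]
      · simp [h, p, q]
    simp_rw [e3]
    rw [Finset.sum_ite]
    simp only [Finset.sum_const, smul_eq_mul]
    change p i * q i + q i * p i = _
    ring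
  have h2 : (K.card : ℝ) * (K.card - 1) * θ ≤ ∑ x ∈ K, ∑ y ∈ K, (sp S x y : ℝ) := by
    have : ∀ x ∈ K, ((K.card : ℝ) - 1) * θ ≤ ∑ y ∈ K, (sp S x y : ℝ) := by
      intro x hx
      rw [← Finset.add_sum_erase _ _ hx]
      have e4 : ∑ y ∈ K.erase x, θ ≤ ∑ y ∈ K.erase x, (sp S x y : ℝ) := by
        apply Finset.sum_le_sum
        intro y hy
        rw [Finset.mem_erase] at hy
        exact hsep x hx y hy.2 hy.1.symm
      rw [Finset.sum_const, Finset.card_erase_of_mem hx, nsmul_eq_mul,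
        Nat.cast_sub (Finset.card_pos.2 hK)] at e4
      have : (0:ℝ) ≤ sp S x x := by positivity
      push_cast at e4
      linarith
    have := Finset.sum_le_sum this
    rw [Finset.sum_const, nsmul_eq_mul] at this
    linarith
  have h3 : ∑ x ∈ K, ∑ y ∈ K, (sp S x y : ℝ) = ∑ i, 2 * ((p i : ℝ) * q i) := by
    exact_mod_cast h1
  have h4 : ∑ i, 2 * ((p i : ℝ) * q i) ≤ ∑ i, 2 * (K.card * ((min (q i) (p i) : ℕ) : ℝ)) := by
    apply Finset.sum_le_sum
    intro i _
    have e5 : (p i : ℝ) + q i = K.card := by exact_mod_cast hpq i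
    have e6 : (0:ℝ) ≤ p i := by positivity
    have e7 : (0:ℝ) ≤ q i := by positivity
    rcases le_total (p i) (q i) with h | h
    · rw [min_eq_right h, ← e5]; nlinarith
    · rw [min_eq_left h, ← e5]; nlinarith
  simp only [← Finset.mul_sum] at h3 h4
  have h5 : (K.card : ℝ) * (((K.card : ℝ) - 1) * θ / 2) ≤ K.card * ∑ i, ((min (q i) (p i) : ℕ) : ℝ) := by
    linarith
  exact le_of_mul_le_mul_left h5 hb

section
variable {X ι : Type*} (S : ι → X → Prop) {s : ℕ}

/-- trace of a point on a sample -/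
def tr (a : Fin s → ι) (x : X) : Finset (Fin s) := Finset.univ.filter fun j => S (a j) x

def cnt (R : Finset X) (a : Fin s → ι) (B : Finset (Fin s)) : ℕ := (R.filter fun x => tr S a x = B).card

def GG (R : Finset X) (a : Fin s → ι) (j : Fin s) : ℕ :=
  ∑ B ∈ Finset.univ.filter (fun B : Finset (Fin s) => j ∉ B), min (cnt S R a B) (cnt S R a (insert j B))

lemma tr_shatter (hD : DualTwo S) (R : Finset X) (a : Fin s → ι) (T : Finset (Fin s))
    (hT : (R.image (tr S a)).Shatters T) : T.card ≤ 2 := by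
  by_contra! h
  obtain ⟨T', hT', hc⟩ := Finset.exists_subset_card_eq (show 3 ≤ T.card by omega)
  have hs := hT.mono_right hT'
  let e := T'.orderEmbOfFin hc
  obtain ⟨pat, hpat⟩ := hD (fun k => a (e k))
  obtain ⟨u, hu, h2⟩ := hs (t := T'.filter fun j => ∃ k, e k = j ∧ pat k) (Finset.filter_subset _ _)
  obtain ⟨x, _, rfl⟩ := Finset.mem_image.1 hu
  apply hpat x
  intro k
  have hk : e k ∈ T' := T'.orderEmbOfFin_mem hc k
  have h3 := Finset.ext_iff.1 h2 (e k)
  simp only [Finset.mem_inter, hk, true_and, tr, Finset.mem_filter, Finset.mem_univ] at h3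
  rw [h3]
  constructor
  · rintro ⟨k', h4, h5⟩
    rwa [e.injective h4] at h5
  · intro h; exact ⟨k, rfl, h⟩

lemma GG_sum (hD : DualTwo S) (R : Finset X) (a : Fin s → ι) : ∑ j, GG S R a j ≤ 2 * R.card := by
  have h1 : ∑ B, cnt S R a B = R.card := by
    unfold cnt
    exact (Finset.card_eq_sum_card_fiberwise (f := tr S a) (t := Finset.univ) (by intro x _; simp)).symm
  rw [← h1]
  apply layer_cake
  intro T hT
  apply tr_shatter S hD R a T
  refine hT.mono_left ?_
  intro B hB
  rw [Finset.mem_filter] at hB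
  obtain ⟨x, hx⟩ := Finset.card_pos.1 hB.2
  rw [Finset.mem_filter] at hx
  exact Finset.mem_image.2 ⟨x, hx⟩

lemma GG_lower [Fintype ι] (hD : DualTwo S) (R : Finset X) (θ : ℝ) (hθ : 0 ≤ θ)
    (hsep : ∀ x ∈ R, ∀ y ∈ R, x ≠ y → θ ≤ sp S x y) (a : Fin s → ι) (j : Fin s) :
    ((R.card : ℝ) - (s + 1) ^ 2) * θ / 2 ≤ ∑ i, (GG S R (Function.update a j i) j : ℝ) := by
  let ρ : X → Finset (Fin s) := fun x => (tr S a x).erase j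
  let K : Finset (Fin s) → Finset X := fun B => R.filter fun x => ρ x = B
  have hin : ∀ i x, j ∈ tr S (Function.update a j i) x ↔ S i x := by
    intro i x; simp [tr]
  have her : ∀ i x, (tr S (Function.update a j i) x).erase j = ρ x := by
    intro i x
    ext k
    by_cases hk : k = j
    · simp [ρ, hk]
    · simp [ρ, hk, tr]
  have hc0 : ∀ i B, j ∉ B → cnt S R (Function.update a j i) B = ((K B).filter fun x => ¬ S i x).card := by
    intro i B hB
    unfold cnt
    rw [Finset.filter_filter]
    congr 1
    apply Finset.filter_congr
    intro x _
    rw [← her i, ← hin i]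
    constructor
    · rintro rfl; exact ⟨Finset.erase_eq_of_notMem hB, hB⟩
    · rintro ⟨h1, h2⟩; rw [← h1, Finset.erase_eq_of_notMem h2]
  have hc1 : ∀ i B, j ∉ B → cnt S R (Function.update a j i) (insert j B) = ((K B).filter fun x => S i x).card := by
    intro i B hB
    unfold cnt
    rw [Finset.filter_filter]
    congr 1
    apply Finset.filter_congr
    intro x _
    rw [← her i, ← hin i]
    constructor
    · intro h; rw [h]; exact ⟨Finset.erase_insert hB, Finset.mem_insert_self _ _⟩
    · rintro ⟨h1, h2⟩; rw [← h1, Finset.insert_erase h2]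
  have h1 : ∑ i, (GG S R (Function.update a j i) j : ℝ) =
      ∑ B ∈ Finset.univ.filter (fun B : Finset (Fin s) => j ∉ B), ∑ i,
        ((min ((K B).filter fun x => ¬ S i x).card ((K B).filter fun x => S i x).card : ℕ) : ℝ) := by
    rw [Finset.sum_comm]
    apply Finset.sum_congr rfl
    intro i _
    unfold GG
    push_cast
    apply Finset.sum_congr rfl
    intro B hB
    have hB' := (Finset.mem_filter.1 hB).2
    rw [hc0 i B hB', hc1 i B hB']
  have hsub : R.image ρ ⊆ Finset.univ.filter (fun B : Finset (Fin s) => j ∉ B) := by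
    intro B hB
    obtain ⟨x, _, rfl⟩ := Finset.mem_image.1 hB
    simp [ρ]
  have h2 : ∑ B ∈ R.image ρ, (((K B).card : ℝ) - 1) * θ / 2 ≤ ∑ i, (GG S R (Function.update a j i) j : ℝ) := by
    rw [h1]
    refine le_trans ?_ (Finset.sum_le_sum_of_subset_of_nonneg hsub ?_)
    · apply Finset.sum_le_sum
      intro B _
      apply class_lemma S (K B) θ hθ
      intro x hx y hy
      exact hsep x (Finset.mem_filter.1 hx).1 y (Finset.mem_filter.1 hy).1
    · intro B _ _
      exact Finset.sum_nonneg fun i _ => Nat.cast_nonneg _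
  have h3 : ∑ B ∈ R.image ρ, (((K B).card : ℝ) - 1) * θ / 2 = ((R.card : ℝ) - (R.image ρ).card) * θ / 2 := by
    have : (R.card : ℝ) = ∑ B ∈ R.image ρ, ((K B).card : ℝ) := by
      exact_mod_cast Finset.card_eq_sum_card_image ρ R
    rw [← Finset.sum_div, ← Finset.sum_mul, Finset.sum_sub_distrib, ← this]
    simp
  have h4 : ((R.image ρ).card : ℝ) ≤ (s + 1) ^ 2 := by
    have e1 : R.image ρ = (R.image (tr S a)).image (fun B => B.erase j) := by
      rw [Finset.image_image]; rfl
    have e2 : (R.image ρ).card ≤ (s + 1) ^ 2 := by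
      rw [e1]
      refine Finset.card_image_le.trans ?_
      have := sauer_pow (R.image (tr S a)) 2 (tr_shatter S hD R a)
      rwa [Fintype.card_fin] at this
    exact_mod_cast e2
  rw [h3] at h2
  refine le_trans ?_ h2
  gcongr

lemma resample [Fintype ι] (j : Fin s) (f : (Fin s → ι) → ℝ) :
    ∑ a, ∑ i, f (Function.update a j i) = Fintype.card ι * ∑ a, f a := by
  rw [← Fintype.sum_prod_type' (f := fun a i => f (Function.update a j i))]
  have : (Fintype.card ι : ℝ) * ∑ a, f a = ∑ z : (Fin s → ι) × ι, f z.1 := by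
    rw [Fintype.sum_prod_type' (f := fun a _ => f a)]
    simp [Finset.mul_sum]
  rw [this]
  let e : (Fin s → ι) × ι ≃ (Fin s → ι) × ι :=
    { toFun := fun z => (Function.update z.1 j z.2, z.1 j)
      invFun := fun z => (Function.update z.1 j z.2, z.1 j)
      left_inv := fun z => by simp
      right_inv := fun z => by simp }
  exact Equiv.sum_comp e (fun z => f z.1)

lemma packing [Fintype ι] [Nonempty ι] (hD : DualTwo S) (R : Finset X) (θ : ℝ) (hθ : 0 ≤ θ)
    (hsep : ∀ x ∈ R, ∀ y ∈ R, x ≠ y → θ ≤ sp S x y) (s : ℕ) :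
    s * (((R.card : ℝ) - (s + 1) ^ 2) * θ) ≤ 4 * R.card * Fintype.card ι := by
  have h1 : ∑ j : Fin s, ∑ a : Fin s → ι, ∑ i, (GG S R (Function.update a j i) j : ℝ)
      = Fintype.card ι * ∑ a : Fin s → ι, ∑ j : Fin s, (GG S R a j : ℝ) := by
    rw [Finset.sum_comm (s := (Finset.univ : Finset (Fin s → ι))), Finset.mul_sum]
    apply Finset.sum_congr rfl
    intro j _
    exact resample j (fun a => (GG S R a j : ℝ))
  have h2 : ∑ a : Fin s → ι, ∑ j : Fin s, (GG S R a j : ℝ) ≤ Fintype.card (Fin s → ι) * (2 * R.card) := by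
    have : ∀ a ∈ (Finset.univ : Finset (Fin s → ι)), ∑ j : Fin s, (GG S R a j : ℝ) ≤ 2 * R.card := by
      intro a _; exact_mod_cast GG_sum S hD R a
    have := Finset.sum_le_card_nsmul _ _ _ this
    rwa [Finset.card_univ, nsmul_eq_mul] at this
  have h3 : (s : ℝ) * (Fintype.card (Fin s → ι) * (((R.card : ℝ) - (s + 1) ^ 2) * θ / 2)) ≤
      ∑ j : Fin s, ∑ a : Fin s → ι, ∑ i, (GG S R (Function.update a j i) j : ℝ) := by
    have : ∀ j ∈ (Finset.univ : Finset (Fin s)), Fintype.card (Fin s → ι) * (((R.card : ℝ) - (s + 1) ^ 2) * θ / 2) ≤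
        ∑ a : Fin s → ι, ∑ i, (GG S R (Function.update a j i) j : ℝ) := by
      intro j _
      have := Finset.card_nsmul_le_sum (Finset.univ : Finset (Fin s → ι)) _ _
        (fun a _ => GG_lower S hD R θ hθ hsep a j)
      rwa [Finset.card_univ, nsmul_eq_mul] at this
    have := Finset.card_nsmul_le_sum _ _ _ this
    rwa [Finset.card_univ, nsmul_eq_mul, Fintype.card_fin] at this
  have hpos : (0:ℝ) < Fintype.card (Fin s → ι) := by exact_mod_cast Fintype.card_pos
  have hN : (0:ℝ) ≤ Fintype.card ι := by positivity
  set M : ℝ := ((Fintype.card (Fin s → ι) : ℕ) : ℝ)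
  have h4 : M * (s * (((R.card : ℝ) - (s + 1) ^ 2) * θ)) ≤ M * (4 * R.card * Fintype.card ι) := by
    nlinarith [mul_le_mul_of_nonneg_left h2 hN]
  exact le_of_mul_le_mul_left h4 hpos

theorem close_pair [Fintype ι] (hD : DualTwo S) (R : Finset X) (hR : 2 ≤ R.card) :
    ∃ x ∈ R, ∃ y ∈ R, x ≠ y ∧ (sp S x y : ℝ) ≤ 48 * Fintype.card ι / Real.sqrt R.card := by
  set N : ℝ := ((Fintype.card ι : ℕ) : ℝ) with hNdef
  set r := Real.sqrt R.card with hr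
  have hn2 : (2:ℝ) ≤ R.card := by exact_mod_cast hR
  have hr0 : 0 < r := Real.sqrt_pos.2 (by linarith)
  have hrr : r * r = R.card := Real.mul_self_sqrt (by linarith)
  have hN0 : 0 ≤ N := by positivity
  have hsple : ∀ x y, (sp S x y : ℝ) ≤ N := by
    intro x y
    have : sp S x y ≤ Fintype.card ι := Finset.card_le_univ _
    rw [hNdef]; exact_mod_cast this
  obtain ⟨x0, hx0, y0, hy0, hxy0⟩ := Finset.one_lt_card.1 (show 1 < R.card by omega)
  rcases le_or_gt r 6 with h6 | h6
  · refine ⟨x0, hx0, y0, hy0, hxy0, (hsple _ _).trans ?_⟩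
    rw [le_div_iff₀ hr0]; nlinarith
  by_contra! hcon
  have hNpos : 0 < N := by
    have h1 := hcon x0 hx0 y0 hy0 hxy0
    have h2 := hsple x0 y0
    have : 0 ≤ 48 * N / r := by positivity
    linarith
  have : Nonempty ι := by
    rw [← Fintype.card_pos_iff]; rw [hNdef] at hNpos; exact_mod_cast hNpos
  have hp := packing S hD R (48 * N / r) (by positivity)
    (fun x hx y hy hxy => (hcon x hx y hy hxy).le) (⌊r / 3⌋₊)
  obtain ⟨x1, hx1, y1, hy1, hxy1⟩ : ∃ x ∈ R, ∃ y ∈ R, x ≠ y := ⟨x0, hx0, y0, hy0, hxy0⟩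
  have f1 := Nat.floor_le (show 0 ≤ r / 3 by positivity)
  have f2 := Nat.lt_floor_add_one (r / 3)
  set σ : ℝ := (⌊r / 3⌋₊ : ℝ)
  have g1 : r / 6 < σ := by linarith
  have g2 : (σ + 1) ^ 2 ≤ r * r / 2 := by nlinarith
  rw [← hrr] at hp
  have g3 : 48 * N / r * r = 48 * N := by field_simp
  set θ := 48 * N / r with hθ
  have hθ0 : 0 < θ := by positivity
  have g4 : r * r / 2 * θ ≤ (r * r - (σ + 1)^2) * θ := by nlinarith
  have g5 : σ * (r * r / 2 * θ) ≤ 4 * (r * r) * N :=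
    (mul_le_mul_of_nonneg_left g4 (by linarith)).trans hp
  have g6 : r / 6 * (r * r / 2 * θ) < σ * (r * r / 2 * θ) :=
    mul_lt_mul_of_pos_right g1 (by positivity)
  have g7 : r / 6 * (r * r / 2 * θ) = 4 * (r * r) * N := by
    linear_combination (r * r / 12) * g3
  linarith

end

end Packing

open Set

noncomputable section Tour
open Classical

lemma cyc_ins_le {X : Type*} (P : X → Prop) (x y : X) (t : List X) :
    cyc (cut P) (y :: x :: t) ≤ cyc (cut P) (x :: t) + 2 * cut P x y := by
  rw [cyc_eq _ _ (by simp), cyc_eq _ (x :: t) (by simp), pc_cons _ _ _ (by simp)]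
  rw [List.getLast_cons (by simp)]
  simp only [List.head_cons]
  have h1 := cut_tri P ((x :: t).getLast (by simp)) x y
  have h2 := cut_comm P x y
  linarith

lemma exp_two_le : Real.exp 2 ≤ 8 := by
  have h := Real.exp_one_lt_d9
  have h2 : Real.exp 2 = Real.exp 1 * Real.exp 1 := by rw [← Real.exp_add]; norm_num
  have := Real.exp_pos 1
  rw [h2]; nlinarith

lemma exp_cut {X : Type*} (P : X → Prop) (x y : X) : Real.exp (2 * cut P x y) ≤ 1 + 7 * cut P x y := by
  unfold cut
  split_ifs
  · simp
  · have := exp_two_le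
    norm_num; linarith

lemma sqrt_step (n : ℕ) : 1 / (2 * Real.sqrt (n + 2)) + Real.sqrt (n + 1) ≤ Real.sqrt (n + 2) := by
  have hn : (0:ℝ) ≤ n := Nat.cast_nonneg n
  set a := Real.sqrt (n + 2) with ha
  set b := Real.sqrt (n + 1) with hb
  have ha2 : a * a = n + 2 := Real.mul_self_sqrt (by linarith)
  have hb2 : b * b = n + 1 := Real.mul_self_sqrt (by linarith)
  have ha0 : 0 < a := Real.sqrt_pos.2 (by linarith)
  have e : 1 / (2 * a) = a - (2 * (a * a) - 1) / (2 * a) := by field_simp; ring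
  have : b ≤ (2 * (a * a) - 1) / (2 * a) := by
    rw [le_div_iff₀ (by positivity)]
    nlinarith [sq_nonneg (a - b)]
  linarith

theorem tour {X κ : Type*} [Fintype κ] (S : κ → X → Prop) (hD : DualTwo S) (n : ℕ) :
    ∀ R : Finset X, R.card = n + 1 → ∀ w : κ → ℕ, ∃ l : List X, l.Nodup ∧ l.toFinset = R ∧
      ∑ c, (w c : ℝ) * Real.exp (cyc (cut (S c)) l) ≤ (∑ c, (w c : ℝ)) * Real.exp (672 * Real.sqrt (n + 1)) := by
  induction n with
  | zero =>
    intro R hR w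
    obtain ⟨x, rfl⟩ := Finset.card_eq_one.1 hR
    refine ⟨[x], by simp, by simp, ?_⟩
    rw [Finset.sum_mul]
    apply Finset.sum_le_sum
    intro c _
    apply mul_le_mul_of_nonneg_left _ (Nat.cast_nonneg _)
    apply Real.exp_le_exp.2
    have : cyc (cut (S c)) [x] = 0 := by simp [cyc, pc, cut_self]
    rw [this]; positivity
  | succ n ih =>
    intro R hR w
    let S' : (Σ c, Fin (w c)) → X → Prop := fun z x => S z.1 x
    have hD' : DualTwo S' := fun i => hD fun k => (i k).1
    obtain ⟨x, hx, y, hy, hxy, hsp⟩ := close_pair S' hD' R (by omega)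
    have hcard : ((Fintype.card (Σ c, Fin (w c)) : ℕ) : ℝ) = ∑ c, (w c : ℝ) := by
      simp
    have hsp2 : (sp S' x y : ℝ) = ∑ c, (w c : ℝ) * cut (S c) x y := by
      unfold sp
      rw [Finset.card_filter]
      push_cast
      rw [Fintype.sum_sigma]
      apply Finset.sum_congr rfl
      intro c _
      simp only [S', cut]
      by_cases h : (S c x ↔ S c y) <;> simp [h]
    rw [hcard, hsp2, hR] at hsp
    push_cast at hsp
    let w' : κ → ℕ := fun c => if (S c x ↔ S c y) then w c else 8 * w c
    have hw' : ∀ c, (w' c : ℝ) = w c * (1 + 7 * cut (S c) x y) := by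
      intro c
      simp only [w', cut]
      split_ifs <;> push_cast <;> ring
    obtain ⟨l, hnd, hl, hsum⟩ := ih (R.erase y) (by rw [Finset.card_erase_of_mem hy]; omega) w'
    have hxl : x ∈ l := by
      rw [← List.mem_toFinset, hl]; exact Finset.mem_erase.2 ⟨hxy, hx⟩
    have hyl : y ∉ l := by
      rw [← List.mem_toFinset, hl]; simp
    obtain ⟨l1, l2, rfl⟩ := List.append_of_mem hxl
    have hperm : (x :: (l2 ++ l1)).Perm (l1 ++ x :: l2) := by
      have := List.perm_append_comm (l₁ := x :: l2) (l₂ := l1)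
      simpa using this
    have hcyc : ∀ c, cyc (cut (S c)) (l1 ++ x :: l2) = cyc (cut (S c)) (x :: (l2 ++ l1)) := by
      intro c; rw [cyc_append_comm]; simp
    refine ⟨y :: x :: (l2 ++ l1), ?_, ?_, ?_⟩
    · refine List.nodup_cons.2 ⟨?_, hperm.nodup_iff.2 hnd⟩
      rwa [hperm.mem_iff]
    · rw [List.toFinset_cons, List.toFinset_eq_of_perm _ _ hperm, hl, Finset.insert_erase hy]
    · have hW0 : 0 ≤ ∑ c, (w c : ℝ) := Finset.sum_nonneg fun c _ => Nat.cast_nonneg _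
      have hs0 : 0 < Real.sqrt ((n:ℝ) + 2) := Real.sqrt_pos.2 (by positivity)
      have e2 : ((n:ℝ) + 1 + 1) = n + 2 := by ring
      calc ∑ c, (w c : ℝ) * Real.exp (cyc (cut (S c)) (y :: x :: (l2 ++ l1)))
          ≤ ∑ c, (w' c : ℝ) * Real.exp (cyc (cut (S c)) (l1 ++ x :: l2)) := by
            apply Finset.sum_le_sum
            intro c _
            rw [hw', hcyc, mul_assoc]
            apply mul_le_mul_of_nonneg_left _ (Nat.cast_nonneg _)
            refine (Real.exp_le_exp.2 (cyc_ins_le (S c) x y _)).trans ?_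
            rw [Real.exp_add, mul_comm]
            exact mul_le_mul_of_nonneg_right (exp_cut _ _ _) (Real.exp_pos _).le
        _ ≤ (∑ c, (w' c : ℝ)) * Real.exp (672 * Real.sqrt (n + 1)) := hsum
        _ ≤ ((∑ c, (w c : ℝ)) * Real.exp (336 / Real.sqrt (n + 2))) * Real.exp (672 * Real.sqrt (n + 1)) := by
            apply mul_le_mul_of_nonneg_right _ (Real.exp_pos _).le
            have e1 : ∑ c, (w' c : ℝ) = ∑ c, (w c : ℝ) + 7 * ∑ c, (w c : ℝ) * cut (S c) x y := by
              rw [Finset.mul_sum, ← Finset.sum_add_distrib]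
              apply Finset.sum_congr rfl
              intro c _; rw [hw']; ring
            rw [e1]
            rw [e2] at hsp
            have h3 := Real.add_one_le_exp (336 / Real.sqrt ((n:ℝ) + 2))
            have h4 := mul_le_mul_of_nonneg_left h3 hW0
            have e3 : 48 * (∑ c, (w c : ℝ)) / Real.sqrt ((n:ℝ) + 2) * 7 = (∑ c, (w c : ℝ)) * (336 / Real.sqrt ((n:ℝ) + 2)) := by
              ring
            linarith
        _ ≤ (∑ c, (w c : ℝ)) * Real.exp (672 * Real.sqrt (((n + 1 : ℕ) : ℝ) + 1)) := by
            rw [mul_assoc, ← Real.exp_add]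
            apply mul_le_mul_of_nonneg_left _ hW0
            apply Real.exp_le_exp.2
            push_cast
            rw [e2]
            have h5 := sqrt_step n
            have e4 : 336 / Real.sqrt ((n:ℝ) + 2) = 672 * (1 / (2 * Real.sqrt ((n:ℝ) + 2))) := by ring
            rw [e4]; linarith

/-- existence of a tour of the whole type with few crossings -/
theorem tour_all {X : Type*} [Fintype X] [Nonempty X] (F : Finset (Finset X))
    (hF : ∀ T, F.Shatters T → T.card ≤ 3)
    (hD : DualTwo (fun (c : F) (x : X) => x ∈ c.1)) :
    ∃ l : List X, l.Nodup ∧ l.toFinset = Finset.univ ∧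
      ∀ c ∈ F, cyc (cut (fun x => x ∈ c)) l ≤ 678 * Real.sqrt (Fintype.card X) := by
  have hpos : 0 < Fintype.card X := Fintype.card_pos
  obtain ⟨n, hn⟩ : ∃ n, Fintype.card X = n + 1 := ⟨Fintype.card X - 1, by omega⟩
  obtain ⟨l, hnd, hl, hsum⟩ := tour (fun (c : F) (x : X) => x ∈ c.1) hD n Finset.univ
    (by rw [Finset.card_univ, hn]) (fun _ => 1)
  refine ⟨l, hnd, hl, fun c hc => ?_⟩
  have h1 : Real.exp (cyc (cut (fun x => x ∈ c)) l) ≤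
      ∑ c : F, ((1:ℕ) : ℝ) * Real.exp (cyc (cut (fun x => x ∈ c.1)) l) := by
    have := Finset.single_le_sum (f := fun c : F => ((1:ℕ) : ℝ) * Real.exp (cyc (cut (fun x => x ∈ c.1)) l))
      (s := Finset.univ) (fun i _ => by positivity) (Finset.mem_univ ⟨c, hc⟩)
    simpa using this
  have hm : (Fintype.card X : ℝ) = n + 1 := by rw [hn]; push_cast; rfl
  have h2 := h1.trans hsum
  rw [← hm] at h2
  set r := Real.sqrt (Fintype.card X) with hr
  have hr0 : 0 ≤ r := Real.sqrt_nonneg _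
  have hrr : r * r = Fintype.card X := Real.mul_self_sqrt (Nat.cast_nonneg _)
  have h3 : (∑ c : F, ((1:ℕ) : ℝ)) ≤ Real.exp (6 * r) := by
    have e1 : (∑ c : F, ((1:ℕ) : ℝ)) = F.card := by simp
    have e2 : (F.card : ℝ) ≤ (Fintype.card X + 1) ^ 3 := by exact_mod_cast sauer_pow F 3 hF
    have e3 : (Fintype.card X : ℝ) + 1 ≤ Real.exp (2 * r) := by
      have h := Real.add_one_le_exp r
      have : Real.exp (2 * r) = Real.exp r * Real.exp r := by rw [← Real.exp_add]; ring_nf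
      rw [this, ← hrr]; nlinarith
    have e4 : Real.exp (6 * r) = Real.exp (2 * r) ^ 3 := by rw [← Real.exp_nat_mul]; ring_nf
    rw [e1, e4]
    exact e2.trans (pow_le_pow_left₀ (by positivity) e3 3)
  have h4 : Real.exp (cyc (cut (fun x => x ∈ c)) l) ≤ Real.exp (6 * r + 672 * r) := by
    rw [Real.exp_add]
    exact h2.trans (mul_le_mul_of_nonneg_right h3 (Real.exp_pos _).le)
  have := Real.exp_le_exp.1 h4
  linarith

end Tour

open Set

noncomputable section GeomCuts
open Classical

lemma dep4 (x y : Fin 4 → ℝ) : ∃ g : Fin 4 → ℝ, g ≠ 0 ∧ ∑ k, g k = 0 ∧ ∑ k, g k * x k = 0 ∧ ∑ k, g k * y k = 0 := by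
  let f : (Fin 4 → ℝ) →ₗ[ℝ] (Fin 3 → ℝ) :=
    { toFun := fun g => ![∑ k, g k, ∑ k, g k * x k, ∑ k, g k * y k]
      map_add' := fun g h => by
        ext j; fin_cases j <;> simp [Finset.sum_add_distrib, add_mul]
      map_smul' := fun r g => by
        ext j; fin_cases j <;> simp [Finset.mul_sum, mul_assoc] }
  have h := LinearMap.ker_ne_bot_of_finrank_lt (f := f) (by simp)
  obtain ⟨g, hg, hg0⟩ := (Submodule.ne_bot_iff _).1 h
  have h0 : f g = 0 := hg
  have h1 := congrFun h0 0
  have h2 := congrFun h0 1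
  have h3 := congrFun h0 2
  exact ⟨g, hg0, h1, h2, h3⟩

lemma dep3 (x y : Fin 3 → ℝ) : ∃ g : Fin 3 → ℝ, g ≠ 0 ∧ ∑ k, g k * x k = 0 ∧ ∑ k, g k * y k = 0 := by
  let f : (Fin 3 → ℝ) →ₗ[ℝ] (Fin 2 → ℝ) :=
    { toFun := fun g => ![∑ k, g k * x k, ∑ k, g k * y k]
      map_add' := fun g h => by
        ext j; fin_cases j <;> simp [Finset.sum_add_distrib, add_mul]
      map_smul' := fun r g => by
        ext j; fin_cases j <;> simp [Finset.mul_sum, mul_assoc] }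
  have h := LinearMap.ker_ne_bot_of_finrank_lt (f := f) (by simp)
  obtain ⟨g, hg, hg0⟩ := (Submodule.ne_bot_iff _).1 h
  have h0 : f g = 0 := hg
  have h1 := congrFun h0 0
  have h2 := congrFun h0 1
  exact ⟨g, hg0, h1, h2⟩

/-- family of half-plane cuts of an indexed point set -/
def HF {ι : Type*} [Fintype ι] (p : ι → Pt) : Finset (Finset ι) :=
  Finset.univ.filter fun T => ∃ a b c : ℝ, ∀ i, i ∈ T ↔ HP a b c (p i)

lemma HF_shatter {ι : Type*} [Fintype ι] (p : ι → Pt) (T : Finset ι) (hT : (HF p).Shatters T) : T.card ≤ 3 := by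
  by_contra! h
  obtain ⟨T', hT', hc⟩ := Finset.exists_subset_card_eq (show 4 ≤ T.card by omega)
  have hs := hT.mono_right hT'
  let e : Fin 4 ≃ T' := (T'.equivFinOfCardEq hc).symm
  obtain ⟨g, hg0, hg1, hg2, hg3⟩ := dep4 (fun k => (p (e k)).1) (fun k => (p (e k)).2)
  obtain ⟨u, hu, h2⟩ := hs (t := T'.filter fun j => ∃ k, (e k : ι) = j ∧ 0 < g k) (Finset.filter_subset _ _)
  obtain ⟨a, b, c, habc⟩ := (Finset.mem_filter.1 hu).2
  have hk : ∀ k, HP a b c (p (e k)) ↔ 0 < g k := by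
    intro k
    have h3 := Finset.ext_iff.1 h2 (e k)
    have hm : (e k : ι) ∈ T' := (e k).2
    simp only [Finset.mem_inter, hm, true_and, Finset.mem_filter] at h3
    rw [← habc, h3]
    constructor
    · rintro ⟨k', h4, h5⟩
      rwa [e.injective (Subtype.ext h4)] at h5
    · intro h; exact ⟨k, rfl, h⟩
  have hz : ∑ k, g k * (a * (p (e k)).1 + b * (p (e k)).2 - c) = 0 := by
    have : ∑ k, g k * (a * (p (e k)).1 + b * (p (e k)).2 - c) =
      a * ∑ k, g k * (p (e k)).1 + b * ∑ k, g k * (p (e k)).2 - c * ∑ k, g k := by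
      simp only [Finset.mul_sum]
      rw [← Finset.sum_add_distrib, ← Finset.sum_sub_distrib]
      apply Finset.sum_congr rfl; intro k _; ring
    rw [this, hg1, hg2, hg3]; ring
  obtain ⟨k0, _, hk0⟩ := Finset.exists_pos_of_sum_zero_of_exists_nonzero g hg1
    (by obtain ⟨k, hk⟩ := Function.ne_iff.1 hg0; exact ⟨k, Finset.mem_univ _, hk⟩)
  have hnn : ∀ k ∈ Finset.univ, 0 ≤ g k * (a * (p (e k)).1 + b * (p (e k)).2 - c) := by
    intro k _
    by_cases h0 : 0 < g k
    · have := (hk k).2 h0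
      unfold HP at this
      apply mul_nonneg h0.le; linarith
    · have := mt (hk k).1 h0
      unfold HP at this
      apply mul_nonneg_of_nonpos_of_nonpos <;> linarith
  have h5 := (Finset.sum_eq_zero_iff_of_nonneg hnn).1 hz k0 (Finset.mem_univ _)
  have h6 := (hk k0).2 hk0
  unfold HP at h6
  have : 0 < g k0 * (a * (p (e k0)).1 + b * (p (e k0)).2 - c) := mul_pos hk0 (by linarith)
  linarith

lemma HF_dual {ι : Type*} [Fintype ι] (p : ι → Pt) : DualTwo (fun (c : HF p) (x : ι) => x ∈ c.1) := by
  intro i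
  have h1 : ∀ k, ∃ a b c : ℝ, ∀ x, (x ∈ (i k).1 ↔ 0 < a * (p x).1 + b * (p x).2 - c) ∧ a * (p x).1 + b * (p x).2 - c ≠ 0 := by
    intro k
    obtain ⟨a, b, c, habc⟩ := (Finset.mem_filter.1 (i k).2).2
    obtain ⟨c', _, hc'⟩ := exists_shift (Finset.univ.image fun x => a * (p x).1 + b * (p x).2) c
    refine ⟨a, b, c', fun x => ?_⟩
    obtain ⟨h2, h3⟩ := hc' (a * (p x).1 + b * (p x).2) (Finset.mem_image.2 ⟨x, Finset.mem_univ _, rfl⟩)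
    refine ⟨?_, fun h => h2 (by linarith)⟩
    rw [habc, sub_pos, ← h3]; rfl
  choose a b c habc using h1
  obtain ⟨g, hg0, hga, hgb⟩ := dep3 a b
  have hz : ∀ x, ∑ k, g k * (a k * (p x).1 + b k * (p x).2 - c k) = - ∑ k, g k * c k := by
    intro x
    have : ∑ k, g k * (a k * (p x).1 + b k * (p x).2 - c k) =
      (∑ k, g k * a k) * (p x).1 + (∑ k, g k * b k) * (p x).2 - ∑ k, g k * c k := by
      simp only [Finset.sum_mul]
      rw [← Finset.sum_add_distrib, ← Finset.sum_sub_distrib]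
      apply Finset.sum_congr rfl; intro k _; ring
    rw [this, hga, hgb]; ring
  by_cases hs : 0 ≤ - ∑ k, g k * c k
  · refine ⟨fun k => g k < 0, fun x hx => ?_⟩
    rw [← hz x] at hs
    have hnp : ∀ k ∈ Finset.univ, g k * (a k * (p x).1 + b k * (p x).2 - c k) ≤ 0 := by
      intro k _
      have h1 := (habc k x).1
      by_cases h0 : g k < 0
      · have := h1.1 ((hx k).2 h0)
        exact mul_nonpos_of_nonpos_of_nonneg h0.le this.le
      · have : ¬ _ := fun h => h0 ((hx k).1 (h1.2 h))
        exact mul_nonpos_of_nonneg_of_nonpos (not_lt.1 h0) (not_lt.1 this)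
    have heq := (Finset.sum_eq_zero_iff_of_nonpos hnp).1 (le_antisymm (Finset.sum_nonpos hnp) hs)
    apply hg0
    ext k
    have := heq k (Finset.mem_univ _)
    rcases mul_eq_zero.1 this with h | h
    · exact h
    · exact absurd h (habc k x).2
  · refine ⟨fun k => 0 < g k, fun x hx => hs ?_⟩
    rw [← hz x]
    apply Finset.sum_nonneg
    intro k _
    have h1 := (habc k x).1
    by_cases h0 : 0 < g k
    · have := h1.1 ((hx k).2 h0)
      exact mul_nonneg h0.le this.le
    · have : ¬ _ := fun h => h0 ((hx k).1 (h1.2 h))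
      exact mul_nonneg_of_nonpos_of_nonpos (not_lt.1 h0) (not_lt.1 this)

theorem rep_tour {ι : Type*} [Fintype ι] [Nonempty ι] (p : ι → Pt) :
    ∃ l : List ι, l.Nodup ∧ l.toFinset = Finset.univ ∧
      ∀ a b c, cyc (cut (fun i => HP a b c (p i))) l ≤ 678 * Real.sqrt (Fintype.card ι) := by
  obtain ⟨l, h1, h2, h3⟩ := tour_all (HF p) (HF_shatter p) (HF_dual p)
  refine ⟨l, h1, h2, fun a b c => ?_⟩
  have := h3 (Finset.univ.filter fun i => HP a b c (p i)) (by
    refine Finset.mem_filter.2 ⟨Finset.mem_univ _, a, b, c, fun i => by simp⟩)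
  simpa using this

end GeomCuts

open Set

noncomputable section Assembly
open Classical

lemma flat_path {ι α : Type*} (c : α → α → ℝ) (htri : ∀ u v w, c u w ≤ c u v + c v w)
    (L : ι → List α) (hL : ∀ i, L i ≠ []) (h : α) :
    ∀ (r : List ι) (hr : r ≠ []), ∃ hf : r.flatMap L ≠ [],
      (r.flatMap L).head hf = (L (r.head hr)).head (hL _) ∧
      pc c (r.flatMap L) + c ((r.flatMap L).getLast hf) h ≤
        (r.map fun i => cyc c (L i)).sum +
          pc (fun i j => c ((L i).head (hL i)) ((L j).head (hL j))) r +
          c ((L (r.getLast hr)).head (hL _)) h := by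
  intro r
  induction r with
  | nil => intro hr; exact absurd rfl hr
  | cons i t ih =>
    intro hr
    cases t with
    | nil =>
      have e : [i].flatMap L = L i := by simp
      refine ⟨by rw [e]; exact hL i, by simp, ?_⟩
      simp only [e, List.map_cons, List.map_nil, List.sum_cons, List.sum_nil, pc, List.getLast_singleton]
      rw [cyc_eq c (L i) (hL i)]
      have := htri ((L i).getLast (hL i)) ((L i).head (hL i)) h
      linarith
    | cons j t =>
      obtain ⟨hf, hh, hle⟩ := ih (by simp)
      have e : (i :: j :: t).flatMap L = L i ++ (j :: t).flatMap L := by simp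
      have hne : L i ++ (j :: t).flatMap L ≠ [] := by simp [hL i]
      refine ⟨by rw [e]; exact hne, ?_, ?_⟩
      · simp only [e]
        rw [List.head_append_of_ne_nil (hL i)]; rfl
      · simp only [e]
        rw [List.getLast_append_of_ne_nil _ hf, pc_append c _ _ (hL i) hf, hh, List.map_cons, List.sum_cons,
          pc, List.getLast_cons (by simp), cyc_eq c (L i) (hL i)]
        have := htri ((L i).getLast (hL i)) ((L i).head (hL i)) ((L j).head (hL j))
        simp only [List.head_cons] at hle ⊢
        linarith

lemma flat_cyc {ι α : Type*} (c : α → α → ℝ) (htri : ∀ u v w, c u w ≤ c u v + c v w)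
    (L : ι → List α) (hL : ∀ i, L i ≠ []) (r : List ι) (hr : r ≠ []) :
    cyc c (r.flatMap L) ≤ (r.map fun i => cyc c (L i)).sum +
      cyc (fun i j => c ((L i).head (hL i)) ((L j).head (hL j))) r := by
  obtain ⟨hf, hh, hle⟩ := flat_path c htri L hL ((L (r.head hr)).head (hL _)) r hr
  rw [cyc_eq c _ hf, cyc_eq _ r hr, hh]
  linarith

lemma big_tour {m : ℕ} (hm : 1 ≤ m) (A : Fin m → Finset Pt) (B : Fin m → Set Pt)
    (hA : ∀ i, (A i).Nonempty) (hdis : ∀ i j, i ≠ j → Disjoint (B i) (B j))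
    (hB : ∀ i, IsJordanCurve (B i)) (hAB : ∀ i, (A i : Set Pt) ⊆ B i) (s : ℝ) (hs : 2 ≤ s)
    (hd : StabLER (⋃ i, B i) s) :
    (TT (Finset.univ.biUnion A) (s + 678 * Real.sqrt m)).Nonempty := by
  have : Nonempty (Fin m) := ⟨⟨0, hm⟩⟩
  obtain ⟨L, hL, hcost⟩ := orders A B hA hdis hB hAB ⌊s⌋₊ hd
  have hLne : ∀ i, L i ≠ [] := by
    intro i h
    have h2 := (hL i).2
    rw [h] at h2
    exact (hA i).ne_empty (by rw [← h2]; simp)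
  obtain ⟨r, hrn, hru0, hrc⟩ := rep_tour (fun i => (L i).head (hLne i))
  have hru : r.toFinset = Finset.univ := by convert hru0
  have hmem : ∀ i, i ∈ r := fun i => by rw [← List.mem_toFinset, hru]; simp
  have hr : r ≠ [] := List.ne_nil_of_mem (hmem ⟨0, hm⟩)
  have hLA : ∀ i x, x ∈ L i ↔ x ∈ A i := fun i x => by rw [← (hL i).2, List.mem_toFinset]
  refine ⟨r.flatMap L, ?_, ?_, fun a b c => ?_⟩
  · rw [List.nodup_flatMap]
    refine ⟨fun i _ => (hL i).1, ?_⟩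
    refine hrn.imp ?_
    intro i j hij x hxi hxj
    exact Set.disjoint_left.1 (hdis i j hij) (hAB i ((hLA i x).1 hxi)) (hAB j ((hLA j x).1 hxj))
  · ext x
    simp [hLA, hmem]
  · have h1 := flat_cyc (cut (HP a b c)) (fun u v w => cut_tri _ u v w) L hLne r hr
    have h2 := hrc a b c
    have h3 := hcost a b c
    rw [← List.sum_toFinset _ hrn, hru] at h1
    rw [Fintype.card_fin] at h2
    have h4 : (⌊s⌋₊ : ℝ) ≤ s := Nat.floor_le (by linarith)
    have h5 : cyc (fun i j => cut (HP a b c) ((L i).head (hLne i)) ((L j).head (hLne j))) r =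
      cyc (cut (fun i => HP a b c ((L i).head (hLne i)))) r := rfl
    linarith

lemma vt_mem_seg {V : Finset Pt} {N : ℝ} {l : List Pt} (hl : l ∈ TT V N) (x : Pt) (hx : x ∈ V) :
    ∃ k, k < l.length ∧ vt l k = x := by
  rw [← hl.2.1, List.mem_toFinset] at hx
  obtain ⟨k, hk, rfl⟩ := List.getElem_of_mem hx
  refine ⟨k, hk, ?_⟩
  rw [vt, Nat.mod_eq_of_lt hk, getElem!_pos l k hk]

lemma jordan_noncol (V : Finset Pt) (hV : ¬ Collinear ℝ (V : Set Pt)) (N : ℝ) (hne : (TT V N).Nonempty) :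
    ∃ J, IsJordanCurve J ∧ (V : Set Pt) ⊆ J ∧ StabLER J N := by
  obtain ⟨l, hl, hs⟩ := uncross V hV N hne
  obtain ⟨J, h1, h2, h3⟩ := poly_jordan hV hl hs
  refine ⟨J, h1, fun x hx => ?_, h3⟩
  obtain ⟨k, _, rfl⟩ := vt_mem_seg hl x hx
  exact h2 k (left_mem_segment ℝ _ _)

lemma tri_jordan (a b c : Pt) (hV : ¬ Collinear ℝ ({a, b, c} : Set Pt)) (N : ℝ) (hN : 2 ≤ N) :
    ∃ J, IsJordanCurve J ∧ segment ℝ a b ⊆ J ∧ StabLER J N := by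
  have hab : a ≠ b := by
    rintro rfl; apply hV; simpa using collinear_pair ℝ a c
  have hac : a ≠ c := by
    rintro rfl; apply hV; rw [Set.insert_comm]; simpa using collinear_pair ℝ b a
  have hbc : b ≠ c := by
    rintro rfl; apply hV; simpa using collinear_pair ℝ a b
  have hV' : ¬ Collinear ℝ ((({a, b, c} : Finset Pt)) : Set Pt) := by
    simpa using hV
  have hne : (TT {a, b, c} N).Nonempty := by
    refine ⟨[a, b, c], by simp [hab, hac, hbc], by ext; simp, fun α β γ => ?_⟩
    refine le_trans ?_ hN
    simp only [cyc, pc, cut]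
    by_cases h1 : HP α β γ a <;> by_cases h2 : HP α β γ b <;> by_cases h3 : HP α β γ c <;>
      simp [h1, h2, h3] <;> norm_num
  obtain ⟨l, hl, hs⟩ := uncross _ hV' N hne
  obtain ⟨J, h1, h2, h3⟩ := poly_jordan hV' hl hs
  refine ⟨J, h1, ?_, h3⟩
  have hlen : l.length = 3 := by
    rw [← List.toFinset_card_of_nodup hl.1, hl.2.1]
    exact Finset.card_eq_three.2 ⟨a, b, c, hab, hac, hbc, rfl⟩
  obtain ⟨i, hi, hia⟩ := vt_mem_seg hl a (by simp)
  obtain ⟨j, hj, hjb⟩ := vt_mem_seg hl b (by simp)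
  have hmod : ∀ u v, u % 3 = v % 3 → vt l u = vt l v := by
    intro u v h; rw [vt, vt, hlen, h]
  have hij : i ≠ j := by rintro rfl; exact hab (hia.symm.trans hjb)
  rw [hlen] at hi hj
  by_cases h : (i + 1) % 3 = j % 3
  · have := h2 i
    rwa [hmod _ _ h, hia, hjb] at this
  · have := h2 j
    rw [hmod (j + 1) i (by omega), hia, hjb] at this
    rwa [segment_symm]

lemma jordan_col (V : Finset Pt) (hV : Collinear ℝ (V : Set Pt)) (N : ℝ) (hN : 2 ≤ N) :
    ∃ J, IsJordanCurve J ∧ (V : Set Pt) ⊆ J ∧ StabLER J N := by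
  obtain ⟨p0, v0, h0⟩ := (collinear_iff_exists_forall_eq_smul_vadd (k := ℝ) _).1 hV
  obtain ⟨v, hv, h1⟩ : ∃ v : Pt, v ≠ 0 ∧ ∀ p ∈ V, ∃ r : ℝ, p = r • v + p0 := by
    by_cases h : v0 = 0
    · refine ⟨(1, 0), by simp, fun p hp => ⟨0, ?_⟩⟩
      obtain ⟨r, hr⟩ := h0 p hp
      simpa [h] using hr
    · exact ⟨v0, h, fun p hp => h0 p hp⟩
  choose! r hr using h1
  obtain ⟨M, hM1, hM⟩ : ∃ M : ℝ, 0 < M ∧ ∀ p ∈ V, |r p| ≤ M := by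
    refine ⟨1 + ∑ p ∈ V, |r p|, ?_, fun p hp => ?_⟩
    · have : 0 ≤ ∑ p ∈ V, |r p| := Finset.sum_nonneg fun _ _ => abs_nonneg _
      linarith
    · have := Finset.single_le_sum (f := fun p => |r p|) (fun i _ => abs_nonneg _) hp
      linarith
  obtain ⟨J, hJ1, hJ2, hJ3⟩ := tri_jordan (p0 - M • v) (p0 + M • v) (p0 + (-v.2, v.1)) (by
    intro hc
    obtain ⟨d, hd⟩ := (collinear_iff_of_mem (p₀ := p0 - M • v) (by simp)).1 hc
    obtain ⟨x, hx⟩ := hd (p0 + M • v) (by simp)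
    obtain ⟨y, hy⟩ := hd (p0 + (-v.2, v.1)) (by simp)
    have x1 := congrArg Prod.fst hx
    have x2 := congrArg Prod.snd hx
    have y1 := congrArg Prod.fst hy
    have y2 := congrArg Prod.snd hy
    simp only [vadd_eq_add, Prod.fst_add, Prod.snd_add, Prod.smul_fst, Prod.smul_snd, Prod.fst_sub,
      Prod.snd_sub, smul_eq_mul] at x1 x2 y1 y2
    have hx1 : x * d.1 = 2 * M * v.1 := by linarith
    have hx2 : x * d.2 = 2 * M * v.2 := by linarith
    have hy1 : y * d.1 = -v.2 + M * v.1 := by linarith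
    have hy2 : y * d.2 = v.1 + M * v.2 := by linarith
    have hz : 2 * M * (v.1 * v.1 + v.2 * v.2) = 0 := by
      have e : (x * d.1) * (y * d.2) = (x * d.2) * (y * d.1) := by ring
      rw [hx1, hx2, hy1, hy2] at e
      linarith
    have hz2 : v.1 * v.1 + v.2 * v.2 = 0 := by
      rcases mul_eq_zero.1 hz with h | h
      · linarith
      · exact h
    apply hv
    ext
    · simp only [Prod.fst_zero]; nlinarith [mul_self_nonneg v.1, mul_self_nonneg v.2]
    · simp only [Prod.snd_zero]; nlinarith [mul_self_nonneg v.1, mul_self_nonneg v.2]) N hN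
  refine ⟨J, hJ1, fun p hp => hJ2 ?_, hJ3⟩
  have hb := abs_le.1 (hM p hp)
  rw [segment_eq_image]
  refine ⟨(r p + M) / (2 * M), ⟨by apply div_nonneg <;> linarith, by rw [div_le_one (by linarith)]; linarith⟩, ?_⟩
  have hp2 := hr p hp
  conv_rhs => rw [hp2]
  ext <;> simp <;> field_simp <;> ring

end Assembly

/-- Theorem 4.6. -/
theorem stmt_12 : ∃ C : ℝ, 0 < C ∧ ∀ m : ℕ, 1 ≤ m →
    ∀ A : Fin m → Finset Pt, ∀ B : Fin m → Set Pt,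
      (∀ i j, i ≠ j → LinSep ↑(A i) ↑(A j)) →
      (∀ i j, i ≠ j → Disjoint (B i) (B j)) →
      (∀ i, IsJordanCurve (B i)) →
      (∀ i, (↑(A i) : Set Pt) ⊆ B i) →
      ∀ s : ℝ, 2 ≤ s → StabLER (⋃ i, B i) s →
        ∃ J, IsJordanCurve J ∧ (⋃ i, (↑(A i) : Set Pt)) ⊆ J ∧
          StabLER J (s + C * Real.sqrt m) := by
  refine ⟨678, by norm_num, ?_⟩
  intro m hm A B _ hdis hB hAB s hs hstab
  have hBne : ∀ i, ∃ p, p ∈ B i := by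
    intro i
    obtain ⟨f, _, _, hf⟩ := hB i
    have hne : (Metric.sphere (0 : EuclideanSpace ℝ (Fin 2)) 1).Nonempty :=
      NormedSpace.sphere_nonempty.2 zero_le_one
    obtain ⟨x, hx⟩ := hne
    exact ⟨f x, by rw [hf]; exact ⟨x, hx, rfl⟩⟩
  choose p hp using hBne
  classical
  obtain ⟨A', hA1, hA2, hA3⟩ : ∃ A' : Fin m → Finset Pt, (∀ i, (A' i).Nonempty) ∧
      (∀ i, (A' i : Set Pt) ⊆ B i) ∧ ∀ i, A i ⊆ A' i := by
    refine ⟨fun i => insert (p i) (A i), fun i => Finset.insert_nonempty _ _, fun i => ?_,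
      fun i => Finset.subset_insert _ _⟩
    intro x hx
    rcases Finset.mem_insert.1 (Finset.mem_coe.1 hx) with rfl | h
    · exact hp i
    · exact hAB i h
  have hT := big_tour hm A' B hA1 hdis hB hA2 s hs hstab
  have hN : 2 ≤ s + 678 * Real.sqrt m := by
    have := Real.sqrt_nonneg (m : ℝ)
    linarith
  have key : ∀ V : Finset Pt, (TT V (s + 678 * Real.sqrt m)).Nonempty → (⋃ i, (↑(A i) : Set Pt)) ⊆ V →
      ∃ J, IsJordanCurve J ∧ (⋃ i, (↑(A i) : Set Pt)) ⊆ J ∧ StabLER J (s + 678 * Real.sqrt m) := by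
    intro V hne hsub
    have : ∃ J, IsJordanCurve J ∧ (V : Set Pt) ⊆ J ∧ StabLER J (s + 678 * Real.sqrt m) := by
      by_cases hV : Collinear ℝ (V : Set Pt)
      · exact jordan_col V hV _ hN
      · exact jordan_noncol V hV _ hne
    obtain ⟨J, h1, h2, h3⟩ := this
    exact ⟨J, h1, hsub.trans h2, h3⟩
  refine key _ hT ?_
  intro x hx
  obtain ⟨i, hi⟩ := mem_iUnion.1 hx
  exact Finset.mem_coe.2 (Finset.mem_biUnion.2 ⟨i, Finset.mem_univ _, hA3 i hi⟩)
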